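/- arXiv:2106.06486 — 2 statements merged into one kernel-verified Lean document; each statement's English description precedes it below -/
import Mathlib

section
/- Let γ > 1 and suppose T satisfies the Functional Correlation Bound with rate n^{−γ} for η-Hölder observables. Then there exists a constant C > 0 such that for every integer n ≥ 1 and all bounded η-Hölder observables v, w : M → ℝ with ∫_M v dμ = ∫_M w dμ = 0, one has ‖𝕊_{v,w}(n)‖_{L^{γ}(μ)} ≤ C n ‖v‖_η ‖w‖_η. -/
open MeasureTheory Function

/-- `T` satisfies the Functional Correlation Bound with rate `n ^ (-γ)` for `η`-Hölder
observables: there is a constant `C₀ > 0` such that for all `0 ≤ p < q`, all monotone sequences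
of times `n_0 ≤ ⋯ ≤ n_{q-1}`, and every bounded separately `η`-Hölder `G : M^q → ℝ`
(with bound `Ginf` on `|G|` and separate Hölder constants `Gh i`), the correlation between
`G(T^{n_0}x, …, T^{n_{q-1}}x)` and the decoupled version (where the first `p` coordinates use
`x₀` and the remaining ones `x₁`) is at most
`C₀ (n_p - n_{p-1})^{-γ} (Ginf + ∑ i, Gh i)`. -/
def FunctionalCorrelationBound {M : Type*} [MetricSpace M] [MeasurableSpace M]
    (μ : Measure M) (T : M → M) (η γ : ℝ) : Prop :=
  ∃ C₀ : ℝ, 0 < C₀ ∧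
    ∀ (q p : ℕ), p < q →
    ∀ n : ℕ → ℕ, Monotone n → n (p - 1) < n p →
    ∀ G : (Fin q → M) → ℝ, Measurable G →
    ∀ Ginf : ℝ, 0 ≤ Ginf → (∀ x, |G x| ≤ Ginf) →
    ∀ Gh : Fin q → ℝ, (∀ i, 0 ≤ Gh i) →
    (∀ (i : Fin q) (x : Fin q → M) (y : M),
        |G x - G (Function.update x i y)| ≤ Gh i * dist (x i) y ^ η) →
    |(∫ x, G (fun i => T^[n i] x) ∂μ) -
        ∫ x₀, ∫ x₁, G (fun i => if (i : ℕ) < p then T^[n i] x₀ else T^[n i] x₁) ∂μ ∂μ|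
      ≤ C₀ * ((n p : ℝ) - (n (p - 1) : ℝ)) ^ (-γ) * (Ginf + ∑ i, Gh i)


/-! ### Elementary inequalities -/

theorem rpow_sub_rpow_le {s x y : ℝ} (hs : 1 ≤ s) (hy : 0 ≤ y) (hyx : y ≤ x) :
    x ^ s - y ^ s ≤ s * x ^ (s - 1) * (x - y) := by
  rcases hy.trans hyx |>.eq_or_lt with hx | hx
  · obtain rfl : y = 0 := le_antisymm (hx ▸ hyx) hy
    simp [← hx]
  have h := one_add_mul_self_le_rpow_one_add (s := y / x - 1) (p := s)
    (by linarith [div_nonneg hy hx.le]) hs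
  rw [add_sub_cancel, Real.div_rpow hy hx.le, le_div_iff₀ (by positivity)] at h
  have hxs : x ^ s = x ^ (s - 1) * x := by
    rw [← Real.rpow_add_one hx.ne']; simp
  have h2 : y / x * x = y := div_mul_cancel₀ _ hx.ne'
  have h3 : (1 + s * (y / x - 1)) * x ^ s = x ^ s - s * x ^ (s - 1) * (x - y) := by
    rw [hxs]; linear_combination (s * x ^ (s - 1)) * h2
  linarith

theorem abs_rpow_abs_sub_le {s B x y : ℝ} (hs : 1 ≤ s) (hx : |x| ≤ B) (hy : |y| ≤ B) :
    |(|x| ^ s - |y| ^ s)| ≤ s * B ^ (s - 1) * |x - y| := by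
  have key : ∀ {x y : ℝ}, |x| ≤ B → |y| ≤ |x| →
      |(|x| ^ s - |y| ^ s)| ≤ s * B ^ (s - 1) * |x - y| := by
    intro x y hx hyx
    rw [abs_of_nonneg (sub_nonneg.2 (Real.rpow_le_rpow (abs_nonneg _) hyx (by linarith)))]
    refine (rpow_sub_rpow_le hs (abs_nonneg y) hyx).trans ?_
    have h1 : |x| ^ (s - 1) ≤ B ^ (s - 1) :=
      Real.rpow_le_rpow (abs_nonneg _) hx (by linarith)
    have h2 : |x| - |y| ≤ |x - y| := abs_sub_abs_le_abs_sub x y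
    have h3 : 0 ≤ |x| ^ (s - 1) := Real.rpow_nonneg (abs_nonneg _) _
    have h4 : 0 ≤ |x| - |y| := sub_nonneg.2 hyx
    have h5 : 0 ≤ s * B ^ (s - 1) := mul_nonneg (by linarith) (h3.trans h1)
    gcongr
  rcases le_total |y| |x| with h | h
  · exact key hx h
  · rw [abs_sub_comm, abs_sub_comm x y]; exact key hy h

theorem add_rpow_le_add_cross {s x y : ℝ} (hs : 1 ≤ s) (hx : 0 ≤ x) (hy : 0 ≤ y) :
    (x + y) ^ s ≤
      x ^ s + y ^ s + s * 2 ^ (s - 1) * (x ^ (s - 1) * y + y ^ (s - 1) * x) := by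
  have key : ∀ {x y : ℝ}, 0 ≤ x → 0 ≤ y → y ≤ x → (x + y) ^ s ≤
      x ^ s + y ^ s + s * 2 ^ (s - 1) * (x ^ (s - 1) * y + y ^ (s - 1) * x) := by
    intro x y hx hy hyx
    have h := rpow_sub_rpow_le hs hx (by linarith : x ≤ x + y)
    have h1 : (x + y) ^ (s - 1) ≤ 2 ^ (s - 1) * x ^ (s - 1) := by
      rw [← Real.mul_rpow (by norm_num) hx]
      exact Real.rpow_le_rpow (by positivity) (by linarith) (by linarith)
    have h2 : s * (x + y) ^ (s - 1) * y ≤ s * (2 ^ (s - 1) * x ^ (s - 1)) * y := by gcongr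
    have h3 : 0 ≤ y ^ s := by positivity
    have h4 : 0 ≤ s * 2 ^ (s - 1) * (y ^ (s - 1) * x) := by positivity
    rw [add_sub_cancel_left] at h
    nlinarith
  rcases le_total y x with h | h
  · exact key hx hy h
  · have := key hy hx h
    rw [add_comm x y]; linarith

theorem rpow_sub_one_le {s x σ ε : ℝ} (hs : 1 ≤ s) (hx : 0 ≤ x) (hσ : 0 < σ) (hε : 0 < ε) :
    x ^ (s - 1) ≤ ε / σ * x ^ s + (σ / ε) ^ (s - 1) := by
  rcases le_total x (σ / ε) with h | h
  · have h1 : x ^ (s - 1) ≤ (σ / ε) ^ (s - 1) := Real.rpow_le_rpow hx h (by linarith)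
    have h2 : 0 ≤ ε / σ * x ^ s := by positivity
    linarith
  · have hx0 : 0 < x := lt_of_lt_of_le (by positivity) h
    have hxs : x ^ s = x ^ (s - 1) * x := by rw [← Real.rpow_add_one hx0.ne']; simp
    have h1 : 1 ≤ ε / σ * x := by
      rw [div_le_iff₀ hε] at h
      rw [div_mul_eq_mul_div, le_div_iff₀ hσ]; linarith
    have h2 : 0 ≤ x ^ (s - 1) := by positivity
    have h3 : 0 ≤ (σ / ε) ^ (s - 1) := by positivity
    rw [hxs]; nlinarith

/-- One half of Clarkson's inequality for real numbers. -/
theorem abs_add_rpow_add_abs_sub_rpow_le {s : ℝ} (hs1 : 1 ≤ s) (hs2 : s ≤ 2) (a b : ℝ) :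
    |a + b| ^ s + |a - b| ^ s ≤ 2 * (|a| ^ s + |b| ^ s) := by
  have sq : ∀ x : ℝ, |x| ^ s = (x ^ 2) ^ (s / 2) := by
    intro x
    rw [← sq_abs, ← Real.rpow_natCast, ← Real.rpow_mul (abs_nonneg _)]
    congr 1; push_cast; ring
  have h0 : 0 ≤ s / 2 := by linarith
  have h1 : s / 2 ≤ 1 := by linarith
  have hc := (Real.concaveOn_rpow h0 h1).right (Set.mem_Ici.2 (sq_nonneg (a + b)))
    (Set.mem_Ici.2 (sq_nonneg (a - b))) (show (0 : ℝ) ≤ 1 / 2 by norm_num)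
    (show (0 : ℝ) ≤ 1 / 2 by norm_num) (by norm_num)
  have hadd : (a ^ 2 + b ^ 2) ^ (s / 2) ≤ (a ^ 2) ^ (s / 2) + (b ^ 2) ^ (s / 2) :=
    Real.rpow_add_le_add_rpow (sq_nonneg a) (sq_nonneg b) h0 h1
  have he : (1 / 2 : ℝ) • (a + b) ^ 2 + (1 / 2 : ℝ) • (a - b) ^ 2 = a ^ 2 + b ^ 2 := by
    simp only [smul_eq_mul]; ring
  rw [he] at hc
  simp only [smul_eq_mul] at hc
  rw [sq, sq, sq, sq]
  linarith

/-- A sequence which is almost subadditive along splittings into two equal pieces and a short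
gap grows at most like `N ^ κ`. -/
theorem exists_bound_of_block_recursion {θ κ : ℝ} (hθ0 : 0 ≤ θ) (hκ : 0 < κ) (hθ : θ < 2 ^ κ) :
    ∃ K : ℕ, 0 < K ∧ ∀ C B : ℝ, 0 ≤ C → ∃ D : ℝ, 0 < D ∧ ∀ u : ℕ → ℝ, u 0 ≤ 0 →
      (∀ N, N < K → u N ≤ B) →
      (∀ a g : ℕ, 0 < a → ((2 * a + g : ℕ) : ℝ) ≤ K * g →
        u (2 * a + g) ≤ θ * u a + u g + C * ((2 * a + g : ℕ) : ℝ) ^ κ) →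
      ∀ N : ℕ, u N ≤ D * (N : ℝ) ^ κ := by
  have h2κ : (0 : ℝ) < 2 ^ κ := by positivity
  have hr : θ / 2 ^ κ < 1 := by rwa [div_lt_one h2κ]
  have hlim : Filter.Tendsto (fun K : ℕ => θ / 2 ^ κ + (3 / (K : ℝ)) ^ κ) Filter.atTop
      (nhds (θ / 2 ^ κ + 0)) := by
    refine Filter.Tendsto.const_add _ ?_
    have h := (tendsto_const_div_atTop_nhds_zero_nat (3 : ℝ)).rpow_const (p := κ)
      (Or.inr hκ.le)
    rwa [Real.zero_rpow hκ.ne'] at h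
  rw [add_zero] at hlim
  obtain ⟨K, hK1, hK4⟩ :=
    ((hlim.eventually_lt_const hr).and (Filter.eventually_ge_atTop 4)).exists
  refine ⟨K, by omega, fun C B hC => ?_⟩
  set r := θ / 2 ^ κ + (3 / (K : ℝ)) ^ κ with hrdef
  have hr0 : 0 < 1 - r := by linarith
  refine ⟨C / (1 - r) + |B| + 1, by positivity, fun u hu0 hB hrec N => ?_⟩
  set D := C / (1 - r) + |B| + 1 with hD
  have hDpos : 0 < D := by positivity
  have hDC : r * D + C ≤ D := by
    have : C = C / (1 - r) * (1 - r) := by field_simp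
    nlinarith [abs_nonneg B]
  induction N using Nat.strong_induction_on with
  | _ N ih =>
    rcases Nat.eq_zero_or_pos N with rfl | hN
    · simpa [Real.zero_rpow hκ.ne'] using hu0
    have hN1 : (1 : ℝ) ≤ N := by exact_mod_cast hN
    rcases lt_or_ge N K with hNK | hNK
    · have h1 : (1 : ℝ) ≤ (N : ℝ) ^ κ := Real.one_le_rpow hN1 hκ.le
      have h2 : 0 ≤ C / (1 - r) := by positivity
      calc u N ≤ B := hB N hNK
        _ ≤ D := by linarith [le_abs_self B]
        _ ≤ D * (N : ℝ) ^ κ := le_mul_of_one_le_right hDpos.le h1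
    · have hm1 : K * (N / K) ≤ N := Nat.mul_div_le N K
      have hm2 : N < K * (N / K + 1) := Nat.lt_mul_div_succ N (by omega)
      have hm3 : 1 ≤ N / K := (Nat.one_le_div_iff (by omega)).2 hNK
      set m := N / K
      have hm4 : 4 * m ≤ N := (Nat.mul_le_mul_right m hK4).trans hm1
      obtain ⟨a, ha⟩ : ∃ a, a = (N - (m + 1)) / 2 := ⟨_, rfl⟩
      obtain ⟨g, hg⟩ : ∃ g, g = N - 2 * a := ⟨_, rfl⟩
      have haN : 2 * a + g = N := by omega
      have hgm : m + 1 ≤ g := by omega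
      have hg3 : g ≤ 3 * m := by omega
      have ha0 : 0 < a := by omega
      have hKpos : (0 : ℝ) < K := by exact_mod_cast (by omega : 0 < K)
      have hgK : (N : ℝ) ≤ K * g := by
        have : N ≤ K * g := hm2.le.trans (Nat.mul_le_mul_left K hgm)
        exact_mod_cast this
      have hgN : (g : ℝ) ≤ 3 / K * N := by
        rw [div_mul_eq_mul_div, le_div_iff₀ hKpos]
        have : g * K ≤ 3 * N := by nlinarith
        exact_mod_cast this
      have haN2 : (a : ℝ) ≤ N / 2 := by
        rw [le_div_iff₀ (by norm_num)]
        have : a * 2 ≤ N := by omega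
        exact_mod_cast this
      have h := hrec a g ha0 (by rw [haN]; exact hgK)
      rw [haN] at h
      have iha := ih a (by omega)
      have ihg := ih g (by omega)
      have ea : (a : ℝ) ^ κ ≤ (N : ℝ) ^ κ / 2 ^ κ := by
        rw [← Real.div_rpow (by positivity) (by norm_num)]
        exact Real.rpow_le_rpow (by positivity) haN2 hκ.le
      have eg : (g : ℝ) ^ κ ≤ (3 / (K : ℝ)) ^ κ * (N : ℝ) ^ κ := by
        rw [← Real.mul_rpow (by positivity) (by positivity)]
        exact Real.rpow_le_rpow (by positivity) hgN hκ.le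
      have hNκ : 0 ≤ (N : ℝ) ^ κ := by positivity
      calc u N ≤ θ * u a + u g + C * (N : ℝ) ^ κ := h
        _ ≤ θ * (D * ((N : ℝ) ^ κ / 2 ^ κ)) + D * ((3 / (K : ℝ)) ^ κ * (N : ℝ) ^ κ)
            + C * (N : ℝ) ^ κ := by
          have h1 : u a ≤ D * ((N : ℝ) ^ κ / 2 ^ κ) := iha.trans (by gcongr)
          have h2 : u g ≤ D * ((3 / (K : ℝ)) ^ κ * (N : ℝ) ^ κ) := ihg.trans (by gcongr)
          gcongr
        _ = (r * D + C) * (N : ℝ) ^ κ := by rw [hrdef]; ring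
        _ ≤ D * (N : ℝ) ^ κ := by gcongr

/-! ### Bounded measurable functions -/

/-- Bounded measurable real functions. -/
def BddMeasurable {Ω : Type*} [MeasurableSpace Ω] (f : Ω → ℝ) : Prop :=
  Measurable f ∧ ∃ C, ∀ x, |f x| ≤ C

namespace BddMeasurable

variable {Ω Ω' : Type*} [MeasurableSpace Ω] [MeasurableSpace Ω'] {f g : Ω → ℝ}

theorem const (c : ℝ) : BddMeasurable (fun _ : Ω => c) :=
  ⟨measurable_const, |c|, fun _ => le_rfl⟩

theorem add (hf : BddMeasurable f) (hg : BddMeasurable g) :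
    BddMeasurable (fun x => f x + g x) := by
  obtain ⟨C, hC⟩ := hf.2
  obtain ⟨D, hD⟩ := hg.2
  exact ⟨hf.1.add hg.1, C + D, fun x => (abs_add_le _ _).trans (add_le_add (hC x) (hD x))⟩

theorem mul (hf : BddMeasurable f) (hg : BddMeasurable g) :
    BddMeasurable (fun x => f x * g x) := by
  obtain ⟨C, hC⟩ := hf.2
  obtain ⟨D, hD⟩ := hg.2
  refine ⟨hf.1.mul hg.1, C * D, fun x => ?_⟩
  rw [abs_mul]
  exact mul_le_mul (hC x) (hD x) (abs_nonneg _) ((abs_nonneg _).trans (hC x))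

theorem neg (hf : BddMeasurable f) : BddMeasurable (fun x => -f x) := by
  obtain ⟨C, hC⟩ := hf.2
  exact ⟨hf.1.neg, C, fun x => by rw [abs_neg]; exact hC x⟩

theorem sub (hf : BddMeasurable f) (hg : BddMeasurable g) :
    BddMeasurable (fun x => f x - g x) := by
  simpa only [sub_eq_add_neg] using hf.add hg.neg

theorem sum {ι : Type*} (s : Finset ι) {F : ι → Ω → ℝ} (hF : ∀ i, BddMeasurable (F i)) :
    BddMeasurable (fun x => ∑ i ∈ s, F i x) := by
  classical
  induction s using Finset.induction_on with
  | empty => simpa using const 0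
  | insert i s hi ih =>
    simp only [Finset.sum_insert hi]
    exact (hF i).add ih

theorem comp (hf : BddMeasurable f) {φ : Ω' → Ω} (hφ : Measurable φ) :
    BddMeasurable (fun x => f (φ x)) := by
  obtain ⟨C, hC⟩ := hf.2
  exact ⟨hf.1.comp hφ, C, fun x => hC _⟩

theorem abs (hf : BddMeasurable f) : BddMeasurable (fun x => |f x|) := by
  obtain ⟨C, hC⟩ := hf.2
  exact ⟨measurable_abs.comp hf.1, C, fun x => by rw [abs_abs]; exact hC x⟩

theorem abs_rpow (hf : BddMeasurable f) {s : ℝ} (hs : 0 ≤ s) :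
    BddMeasurable (fun x => |f x| ^ s) := by
  obtain ⟨C, hC⟩ := hf.2
  refine ⟨hf.abs.1.pow_const s, C ^ s, fun x => ?_⟩
  rw [abs_of_nonneg (Real.rpow_nonneg (abs_nonneg _) _)]
  exact Real.rpow_le_rpow (abs_nonneg _) (hC x) hs

theorem integrable (hf : BddMeasurable f) (μ : Measure Ω) [IsFiniteMeasure μ] :
    Integrable f μ := by
  obtain ⟨C, hC⟩ := hf.2
  exact Integrable.of_bound hf.1.aestronglyMeasurable C (Filter.Eventually.of_forall hC)

theorem memLp (hf : BddMeasurable f) (μ : Measure Ω) [IsFiniteMeasure μ] (p : ENNReal) :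
    MemLp f p μ := by
  obtain ⟨C, hC⟩ := hf.2
  exact MemLp.of_bound hf.1.aestronglyMeasurable C (Filter.Eventually.of_forall hC)

theorem integral_right {F : Ω × Ω' → ℝ} (hF : BddMeasurable F) (μ : Measure Ω')
    [IsProbabilityMeasure μ] : BddMeasurable (fun x => ∫ y, F (x, y) ∂μ) := by
  obtain ⟨C, hC⟩ := hF.2
  refine ⟨hF.1.stronglyMeasurable.integral_prod_right'.measurable, C, fun x => ?_⟩
  have h := norm_integral_le_of_norm_le_const (μ := μ) (f := fun y => F (x, y))
    (Filter.Eventually.of_forall fun y => hC (x, y))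
  simpa using h

end BddMeasurable

/-! ### `L^s` norms of bounded measurable functions -/

section LpNorm

variable {Ω Ω' : Type*} [MeasurableSpace Ω] [MeasurableSpace Ω'] {μ : Measure Ω}
  {μ' : Measure Ω'} {f g : Ω → ℝ} {s : ℝ}

theorem lpNorm_rpow_eq_integral (hs : 0 < s) (hf : BddMeasurable f) :
    lpNorm f (ENNReal.ofReal s) μ ^ s = ∫ x, |f x| ^ s ∂μ := by
  rw [lpNorm_eq_integral_norm_rpow_toReal (by simpa using hs) ENNReal.ofReal_ne_top
    hf.1.aestronglyMeasurable, ENNReal.toReal_ofReal hs.le,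
    ← Real.rpow_mul (integral_nonneg fun x => by positivity), inv_mul_cancel₀ hs.ne',
    Real.rpow_one]
  rfl

theorem lpNorm_le_of_integral_le (hs : 0 < s) (hf : BddMeasurable f) {K : ℝ} (hK : 0 ≤ K)
    (h : ∫ x, |f x| ^ s ∂μ ≤ K ^ s) : lpNorm f (ENNReal.ofReal s) μ ≤ K := by
  rw [← lpNorm_rpow_eq_integral hs hf] at h
  exact (Real.rpow_le_rpow_iff lpNorm_nonneg hK hs).1 h

theorem lpNorm_comp_measurePreserving' (hf : BddMeasurable f) {φ : Ω' → Ω}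
    (hφ : MeasurePreserving φ μ' μ) (p : ENNReal) :
    lpNorm (fun x => f (φ x)) p μ' = lpNorm f p μ := by
  rw [← toReal_eLpNorm (hf.comp hφ.measurable).1.aestronglyMeasurable,
    ← toReal_eLpNorm hf.1.aestronglyMeasurable]
  congr 1
  exact eLpNorm_comp_measurePreserving hf.1.aestronglyMeasurable hφ

theorem lpNorm_add_le_of_bddMeasurable [IsProbabilityMeasure μ] (hs : 1 ≤ s)
    (hf : BddMeasurable f) :
    lpNorm (fun x => f x + g x) (ENNReal.ofReal s) μ ≤
      lpNorm f (ENNReal.ofReal s) μ + lpNorm g (ENNReal.ofReal s) μ :=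
  lpNorm_add_le (hf.memLp μ _) (by simpa using hs)

theorem lpNorm_sub_le_of_bddMeasurable [IsProbabilityMeasure μ] (hs : 1 ≤ s)
    (hf : BddMeasurable f) :
    lpNorm (fun x => f x - g x) (ENNReal.ofReal s) μ ≤
      lpNorm f (ENNReal.ofReal s) μ + lpNorm g (ENNReal.ofReal s) μ :=
  lpNorm_sub_le (hf.memLp μ _) (by simpa using hs)

theorem lpNorm_le_of_abs_le [IsProbabilityMeasure μ] (hs : 0 < s) (hf : BddMeasurable f) {K : ℝ}
    (hK : 0 ≤ K) (h : ∀ x, |f x| ≤ K) : lpNorm f (ENNReal.ofReal s) μ ≤ K := by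
  refine lpNorm_le_of_integral_le hs hf hK ?_
  calc ∫ x, |f x| ^ s ∂μ ≤ ∫ _, K ^ s ∂μ :=
        integral_mono ((hf.abs_rpow hs.le).integrable μ) (integrable_const _)
          fun x => Real.rpow_le_rpow (abs_nonneg _) (h x) hs.le
    _ = K ^ s := by simp

theorem lpNorm_mono_exponent [IsProbabilityMeasure μ] {t : ℝ} (hst : s ≤ t)
    (hf : BddMeasurable f) :
    lpNorm f (ENNReal.ofReal s) μ ≤ lpNorm f (ENNReal.ofReal t) μ := by
  rw [← toReal_eLpNorm hf.1.aestronglyMeasurable, ← toReal_eLpNorm hf.1.aestronglyMeasurable]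
  exact ENNReal.toReal_mono (hf.memLp μ _).eLpNorm_ne_top
    (eLpNorm_le_eLpNorm_of_exponent_le (ENNReal.ofReal_le_ofReal hst) hf.1.aestronglyMeasurable)

theorem integral_abs_le_lpNorm [IsProbabilityMeasure μ] (hs : 1 ≤ s) (hf : BddMeasurable f) :
    ∫ x, |f x| ∂μ ≤ lpNorm f (ENNReal.ofReal s) μ := by
  have h := lpNorm_mono_exponent (μ := μ) hs hf
  rwa [ENNReal.ofReal_one, lpNorm_one_eq_integral_norm hf.1.aestronglyMeasurable] at h

theorem lpNorm_mul_le [IsProbabilityMeasure μ] (hf : BddMeasurable f)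
    (hg : BddMeasurable g) :
    lpNorm (fun x => f x * g x) (ENNReal.ofReal s) μ ≤
      lpNorm f (ENNReal.ofReal (2 * s)) μ * lpNorm g (ENNReal.ofReal (2 * s)) μ := by
  have : ENNReal.HolderTriple (ENNReal.ofReal (2 * s)) (ENNReal.ofReal (2 * s))
      (ENNReal.ofReal s) := ⟨by
    rw [ENNReal.ofReal_mul (by norm_num), ENNReal.mul_inv (by simp) (by simp), ← add_mul,
      ENNReal.ofReal_ofNat, ENNReal.inv_two_add_inv_two, one_mul]⟩
  have h : eLpNorm (fun x => f x * g x) (ENNReal.ofReal s) μ ≤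
      eLpNorm f (ENNReal.ofReal (2 * s)) μ * eLpNorm g (ENNReal.ofReal (2 * s)) μ :=
    eLpNorm_smul_le_mul_eLpNorm (φ := f) (f := g) hg.1.aestronglyMeasurable
      hf.1.aestronglyMeasurable
  rw [← toReal_eLpNorm (hf.mul hg).1.aestronglyMeasurable,
    ← toReal_eLpNorm hf.1.aestronglyMeasurable, ← toReal_eLpNorm hg.1.aestronglyMeasurable,
    ← ENNReal.toReal_mul]
  exact ENNReal.toReal_mono
    (ENNReal.mul_ne_top (hf.memLp μ _).eLpNorm_ne_top (hg.memLp μ _).eLpNorm_ne_top) h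

end LpNorm

/-! ### Moments of sums of independent copies -/

section Independent

variable {Ω : Type*} [MeasurableSpace Ω] {μ : Measure Ω} [IsProbabilityMeasure μ]
  {X : Ω → ℝ} {s : ℝ}

theorem integrable_const_add_mul {P : Ω → ℝ} (hP : Integrable P μ) (α β : ℝ) :
    Integrable (fun x => α + β * P x) μ :=
  (integrable_const _).add (hP.const_mul _)

theorem integrable_const_add_mul_add_mul {P Q : Ω → ℝ} (hP : Integrable P μ)
    (hQ : Integrable Q μ) (α β δ : ℝ) : Integrable (fun x => α + β * P x + δ * Q x) μ :=
  (integrable_const_add_mul hP α β).add (hQ.const_mul _)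

theorem integral_const_add_mul_add_mul {P Q : Ω → ℝ} (hP : Integrable P μ)
    (hQ : Integrable Q μ) (α β δ : ℝ) :
    ∫ x, (α + β * P x + δ * Q x) ∂μ = α + β * ∫ x, P x ∂μ + δ * ∫ x, Q x ∂μ := by
  rw [integral_add (integrable_const_add_mul hP α β) (hQ.const_mul _),
    integral_add (integrable_const _) (hP.const_mul _), integral_const_mul, integral_const_mul]
  simp

theorem bddMeasurable_fst_add_snd (hX : BddMeasurable X) :
    BddMeasurable (fun z : Ω × Ω => X z.1 + X z.2) :=
  (hX.comp measurable_fst).add (hX.comp measurable_snd)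

theorem bddMeasurable_fst_sub_snd (hX : BddMeasurable X) :
    BddMeasurable (fun z : Ω × Ω => X z.1 - X z.2) :=
  (hX.comp measurable_fst).sub (hX.comp measurable_snd)

/-- If the first moment of `X` is of order `σ`, then the `s`-th moment of a sum of two
independent copies is at most `θ ^ s` times that of `X`, up to an error of order `σ ^ s`. -/
theorem exists_integral_integral_add_rpow_le {θ c : ℝ} (μ : Measure Ω) [IsProbabilityMeasure μ]
    (hs : 1 ≤ s) (hθ : 2 < θ ^ s) (hc : 0 ≤ c) :
    ∃ C : ℝ, 0 ≤ C ∧ ∀ σ : ℝ, 0 < σ → ∀ X : Ω → ℝ, BddMeasurable X → ∫ x, |X x| ∂μ ≤ c * σ →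
      ∫ x, ∫ y, |X x + X y| ^ s ∂μ ∂μ ≤ θ ^ s * ∫ x, |X x| ^ s ∂μ + C * σ ^ s := by
  have hs0 : 0 < s := by linarith
  obtain ⟨A, hA⟩ : ∃ A, A = s * (2 : ℝ) ^ (s - 1) := ⟨_, rfl⟩
  have hApos : 0 < A := by rw [hA]; positivity
  obtain ⟨ε, hε⟩ : ∃ ε, ε = (θ ^ s - 2) / (2 * A * (c + 1)) := ⟨_, rfl⟩
  have hεpos : 0 < ε := by
    rw [hε]; exact div_pos (by linarith) (by positivity)
  have hεeq : 2 * A * ε * c ≤ θ ^ s - 2 := by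
    have : ε * (2 * A * (c + 1)) = θ ^ s - 2 := by
      rw [hε]; exact div_mul_cancel₀ _ (by positivity)
    nlinarith [mul_pos hApos hεpos]
  refine ⟨2 * A * c / ε ^ (s - 1), by positivity, fun σ hσ X hX hX1 => ?_⟩
  set I := ∫ x, |X x| ^ s ∂μ with hI
  set J := ∫ x, |X x| ∂μ with hJ
  have hI0 : 0 ≤ I := integral_nonneg fun x => by positivity
  have hXs : Integrable (fun x => |X x| ^ s) μ := (hX.abs_rpow hs0.le).integrable μ
  have hXa : Integrable (fun x => |X x|) μ := hX.abs.integrable μ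
  set k := (σ / ε) ^ (s - 1) with hk
  have hkpos : 0 ≤ k := by positivity
  have hpt : ∀ x y, |X x + X y| ^ s ≤
      (|X x| ^ s + A * k * |X x|) + (1 + A * (ε / σ) * |X x|) * |X y| ^ s
        + (A * (ε / σ * |X x| ^ s + k)) * |X y| := by
    intro x y
    have h1 := add_rpow_le_add_cross hs (abs_nonneg (X x)) (abs_nonneg (X y))
    rw [← hA] at h1
    have h2 : |X x + X y| ^ s ≤ (|X x| + |X y|) ^ s :=
      Real.rpow_le_rpow (abs_nonneg _) (abs_add_le _ _) hs0.le
    have h3 := mul_le_mul_of_nonneg_right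
      (rpow_sub_one_le hs (abs_nonneg (X x)) hσ hεpos) (abs_nonneg (X y))
    have h4 := mul_le_mul_of_nonneg_right
      (rpow_sub_one_le hs (abs_nonneg (X y)) hσ hεpos) (abs_nonneg (X x))
    have h5 := mul_le_mul_of_nonneg_left (add_le_add h3 h4) hApos.le
    linarith
  have hF : BddMeasurable (fun z : Ω × Ω => |X z.1 + X z.2| ^ s) :=
    (bddMeasurable_fst_add_snd hX).abs_rpow hs0.le
  have hin : ∀ x, ∫ y, |X x + X y| ^ s ∂μ ≤
      (I + A * k * J) + (1 + A * (ε / σ) * J) * |X x| ^ s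
        + (A * (ε / σ * I + k)) * |X x| := by
    intro x
    calc ∫ y, |X x + X y| ^ s ∂μ ≤ ∫ y, ((|X x| ^ s + A * k * |X x|)
          + (1 + A * (ε / σ) * |X x|) * |X y| ^ s
          + (A * (ε / σ * |X x| ^ s + k)) * |X y|) ∂μ :=
          integral_mono ((((BddMeasurable.const (X x)).add hX).abs_rpow hs0.le).integrable μ)
            (integrable_const_add_mul_add_mul hXs hXa _ _ _) (hpt x)
      _ = _ := by
        rw [integral_const_add_mul_add_mul hXs hXa, ← hI, ← hJ]; ring
  have hout : ∫ x, ∫ y, |X x + X y| ^ s ∂μ ∂μ ≤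
      (I + A * k * J) + (1 + A * (ε / σ) * J) * I + (A * (ε / σ * I + k)) * J := by
    refine (integral_mono ((hF.integral_right μ).integrable μ)
      (integrable_const_add_mul_add_mul hXs hXa _ _ _) hin).trans ?_
    rw [integral_const_add_mul_add_mul hXs hXa]
  have hkσ : k * σ = σ ^ s / ε ^ (s - 1) := by
    rw [hk, Real.div_rpow hσ.le hεpos.le, div_mul_eq_mul_div, ← Real.rpow_add_one hσ.ne']
    simp
  have h1 : A * k * J ≤ A * k * (c * σ) := by gcongr
  have h2 : A * (ε / σ) * I * J ≤ A * (ε / σ) * I * (c * σ) := by gcongr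
  have h3 : A * (ε / σ) * I * (c * σ) = A * ε * c * I := by field_simp
  have h4 : A * k * (c * σ) = A * c / ε ^ (s - 1) * σ ^ s := by
    rw [show A * k * (c * σ) = A * c * (k * σ) by ring, hkσ]; ring
  have h5 := mul_le_mul_of_nonneg_right hεeq hI0
  have h6 : 2 * A * c / ε ^ (s - 1) * σ ^ s = 2 * (A * c / ε ^ (s - 1) * σ ^ s) := by ring
  rw [h6]
  linarith

theorem integral_integral_const_add_sub_rpow_le (hs1 : 1 ≤ s) (hs2 : s ≤ 2)
    (hX : BddMeasurable X) (e : ℝ) :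
    ∫ x, ∫ y, |e + (X y - X x)| ^ s ∂μ ∂μ ≤
      |e| ^ s + ∫ x, ∫ y, |X y - X x| ^ s ∂μ ∂μ := by
  have hs0 : 0 ≤ s := by linarith
  have hd : BddMeasurable (fun z : Ω × Ω => X z.2 - X z.1) :=
    (hX.comp measurable_snd).sub (hX.comp measurable_fst)
  have hp : BddMeasurable (fun z : Ω × Ω => |e + (X z.2 - X z.1)| ^ s) :=
    ((BddMeasurable.const e).add hd).abs_rpow hs0
  have hm : BddMeasurable (fun z : Ω × Ω => |e - (X z.2 - X z.1)| ^ s) :=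
    ((BddMeasurable.const e).sub hd).abs_rpow hs0
  have hds : BddMeasurable (fun z : Ω × Ω => |X z.2 - X z.1| ^ s) := hd.abs_rpow hs0
  have hswap : ∫ x, ∫ y, |e + (X y - X x)| ^ s ∂μ ∂μ =
      ∫ z, |e - (X z.2 - X z.1)| ^ s ∂(μ.prod μ) := by
    rw [integral_integral_swap (hp.integrable (μ.prod μ)), ← integral_prod _
      ((show BddMeasurable (fun z : Ω × Ω => |e + (X z.1 - X z.2)| ^ s) from
        ((BddMeasurable.const e).add (bddMeasurable_fst_sub_snd hX)).abs_rpow hs0).integrable _)]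
    congr 1; ext z; congr 2; ring
  have hplain : ∫ x, ∫ y, |e + (X y - X x)| ^ s ∂μ ∂μ =
      ∫ z, |e + (X z.2 - X z.1)| ^ s ∂(μ.prod μ) := (integral_prod _ (hp.integrable _)).symm
  have hsum : ∫ z, (|e + (X z.2 - X z.1)| ^ s + |e - (X z.2 - X z.1)| ^ s) ∂(μ.prod μ) ≤
      ∫ z, (2 * (|e| ^ s + |X z.2 - X z.1| ^ s)) ∂(μ.prod μ) :=
    integral_mono ((hp.add hm).integrable _)
      ((((BddMeasurable.const (|e| ^ s)).add hds).integrable _).const_mul 2)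
      fun z => abs_add_rpow_add_abs_sub_rpow_le hs1 hs2 e _
  rw [integral_add (hp.integrable _) (hm.integrable _), integral_const_mul,
    integral_add (integrable_const _) (hds.integrable _),
    integral_prod _ (hds.integrable _), ← hswap, ← hplain] at hsum
  simp only [integral_const, probReal_univ, one_smul] at hsum
  linarith

/-- If sums `X + X ∘ φ` behave up to an error `E` like sums of two independent copies of `X`, then
the symmetrised `s`-th moment is additive up to `2 * E`, for `1 ≤ s ≤ 2`. -/
theorem integral_integral_symmetrised_rpow_le (hs1 : 1 ≤ s) (hs2 : s ≤ 2)
    (hX : BddMeasurable X) {φ : Ω → Ω} (hφ : Measurable φ) {R E : ℝ} (hR : ∀ x, |X x| ≤ R)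
    (hE : ∀ c : ℝ, |c| ≤ 2 * R →
      ∫ x, |X x + X (φ x) + c| ^ s ∂μ ≤ ∫ x, ∫ y, |X x + X y + c| ^ s ∂μ ∂μ + E) :
    ∫ y, ∫ x, |(X x + X (φ x)) - (X y + X (φ y))| ^ s ∂μ ∂μ ≤
      2 * ∫ x, ∫ y, |X y - X x| ^ s ∂μ ∂μ + 2 * E := by
  have hs0 : 0 ≤ s := by linarith
  obtain ⟨h, hh⟩ : ∃ h : Ω → ℝ, h = fun x => X x + X (φ x) := ⟨_, rfl⟩
  have hhb : BddMeasurable h := hh ▸ hX.add (hX.comp hφ)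
  obtain ⟨k, hk⟩ : ∃ k : Ω × Ω → ℝ, k = fun z => X z.1 + X z.2 := ⟨_, rfl⟩
  have hkb : BddMeasurable k := hk ▸ bddMeasurable_fst_add_snd hX
  have hcR : ∀ x y, |-(X x + X y)| ≤ 2 * R := fun x y => by
    rw [abs_neg]; linarith [abs_add_le (X x) (X y), hR x, hR y]
  have hE' : ∀ c : ℝ, |c| ≤ 2 * R →
      ∫ x, |h x + c| ^ s ∂μ ≤ ∫ z, |k z + c| ^ s ∂(μ.prod μ) + E := by
    intro c hc
    rw [integral_prod _ (((hkb.add (.const c)).abs_rpow hs0).integrable _), hh, hk]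
    exact hE c hc
  have b1 : BddMeasurable (fun z : Ω × Ω => |h z.2 + -h z.1| ^ s) :=
    ((hhb.comp measurable_snd).add (hhb.comp measurable_fst).neg).abs_rpow hs0
  have b2 : BddMeasurable (fun z : Ω × (Ω × Ω) => |k z.2 + -h z.1| ^ s) :=
    ((hkb.comp measurable_snd).add (hhb.comp measurable_fst).neg).abs_rpow hs0
  have b3 : BddMeasurable (fun z : (Ω × Ω) × Ω => |h z.2 + -k z.1| ^ s) :=
    ((hhb.comp measurable_snd).add (hkb.comp measurable_fst).neg).abs_rpow hs0
  have b4 : BddMeasurable (fun z : (Ω × Ω) × (Ω × Ω) => |k z.2 + -k z.1| ^ s) :=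
    ((hkb.comp measurable_snd).add (hkb.comp measurable_fst).neg).abs_rpow hs0
  have step1 : ∫ y, ∫ x, |h x + -h y| ^ s ∂μ ∂μ ≤
      ∫ y, (∫ z, |k z + -h y| ^ s ∂(μ.prod μ)) ∂μ + E := by
    calc _ ≤ ∫ y, (∫ z, |k z + -h y| ^ s ∂(μ.prod μ) + E) ∂μ :=
          integral_mono ((b1.integral_right μ).integrable μ)
            (((b2.integral_right (μ.prod μ)).integrable μ).add (integrable_const E))
            fun y => hE' (-h y) (by rw [hh]; exact hcR _ _)
      _ = _ := by
        rw [integral_add ((b2.integral_right (μ.prod μ)).integrable μ) (integrable_const E)]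
        simp
  have step2 : ∫ y, (∫ z, |k z + -h y| ^ s ∂(μ.prod μ)) ∂μ ≤
      ∫ z, (∫ w, |k w + -k z| ^ s ∂(μ.prod μ)) ∂(μ.prod μ) + E := by
    rw [integral_integral_swap (b2.integrable (μ.prod (μ.prod μ)))]
    calc _ = ∫ z, (∫ y, |h y + -k z| ^ s ∂μ) ∂(μ.prod μ) := by
          congr 1; ext z; congr 1; ext y; rw [← abs_neg]; congr 2; ring
      _ ≤ ∫ z, (∫ w, |k w + -k z| ^ s ∂(μ.prod μ) + E) ∂(μ.prod μ) :=
          integral_mono ((b3.integral_right μ).integrable _)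
            (((b4.integral_right (μ.prod μ)).integrable _).add (integrable_const E))
            fun z => hE' (-k z) (by rw [hk]; exact hcR _ _)
      _ = _ := by
        rw [integral_add ((b4.integral_right (μ.prod μ)).integrable _) (integrable_const E)]
        simp
  have step3 : ∫ z, (∫ w, |k w + -k z| ^ s ∂(μ.prod μ)) ∂(μ.prod μ) ≤
      2 * ∫ x, ∫ y, |X y - X x| ^ s ∂μ ∂μ := by
    set D := ∫ x, ∫ y, |X y - X x| ^ s ∂μ ∂μ with hD
    have hd : BddMeasurable (fun z : Ω × Ω => X z.2 - X z.1) :=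
      (hX.comp measurable_snd).sub (hX.comp measurable_fst)
    have b5 : BddMeasurable (fun z : (Ω × Ω) × (Ω × Ω) =>
        |(X z.1.2 - X z.1.1) + (X z.2.2 - X z.2.1)| ^ s) :=
      ((hd.comp measurable_fst).add (hd.comp measurable_snd)).abs_rpow hs0
    have e1 : ∫ z, (∫ w, |k w + -k z| ^ s ∂(μ.prod μ)) ∂(μ.prod μ) =
        ∫ x, ∫ x', ∫ y, ∫ y', |(X y - X x) + (X y' - X x')| ^ s ∂μ ∂μ ∂μ ∂μ := by
      rw [integral_prod _ ((b4.integral_right (μ.prod μ)).integrable _)]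
      congr 1; ext x; congr 1; ext x'
      change ∫ w, |k w + -k (x, x')| ^ s ∂(μ.prod μ) = _
      rw [integral_prod _ (((hkb.add (.const _)).abs_rpow hs0).integrable _)]
      congr 1; ext y; congr 1; ext y'
      rw [hk]; congr 2; ring
    have e2 : ∀ x, ∫ x', ∫ y, ∫ y', |(X y - X x) + (X y' - X x')| ^ s ∂μ ∂μ ∂μ =
        ∫ y, ∫ x', ∫ y', |(X y - X x) + (X y' - X x')| ^ s ∂μ ∂μ ∂μ := by
      intro x
      refine integral_integral_swap (f := fun x' y => ∫ y', |(X y - X x) + (X y' - X x')| ^ s ∂μ)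
        (BddMeasurable.integrable ?_ (μ.prod μ))
      exact (b5.comp (φ := fun q : (Ω × Ω) × Ω => ((x, q.1.2), (q.1.1, q.2)))
        (by fun_prop)).integral_right μ
    have b6 : BddMeasurable (fun z : Ω × Ω =>
        ∫ w, |(X z.2 - X z.1) + (X w.2 - X w.1)| ^ s ∂(μ.prod μ)) :=
      b5.integral_right (μ.prod μ)
    have e3 : ∀ x y, ∫ x', ∫ y', |(X y - X x) + (X y' - X x')| ^ s ∂μ ∂μ =
        ∫ w, |(X y - X x) + (X w.2 - X w.1)| ^ s ∂(μ.prod μ) := fun x y =>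
      (integral_prod _ ((((BddMeasurable.const _).add hd).abs_rpow hs0).integrable _)).symm
    rw [e1]
    simp only [e2, e3]
    rw [← integral_prod (fun z : Ω × Ω =>
      ∫ w, |(X z.2 - X z.1) + (X w.2 - X w.1)| ^ s ∂(μ.prod μ)) (b6.integrable _)]
    have hds : Integrable (fun z : Ω × Ω => |X z.2 - X z.1| ^ s) (μ.prod μ) :=
      (hd.abs_rpow hs0).integrable _
    calc _ ≤ ∫ z : Ω × Ω, (|X z.2 - X z.1| ^ s + D) ∂(μ.prod μ) :=
          integral_mono (b6.integrable _) (hds.add (integrable_const D)) fun z => by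
            have := integral_integral_const_add_sub_rpow_le (μ := μ) hs1 hs2 hX (X z.2 - X z.1)
            simpa only [e3] using this
      _ = 2 * D := by
        rw [integral_add hds (integrable_const D), integral_prod _ hds, ← hD]
        simp; ring
  have e0 : ∫ y, ∫ x, |(X x + X (φ x)) - (X y + X (φ y))| ^ s ∂μ ∂μ =
      ∫ y, ∫ x, |h x + -h y| ^ s ∂μ ∂μ := by
    rw [hh]; rfl
  rw [e0]; linarith

end Independent

/-! ### Decoupling of blocks -/

theorem integral_comp_measurePreserving {Ω : Type*} [MeasurableSpace Ω] {μ : Measure Ω}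
    {φ : Ω → Ω} (hφ : MeasurePreserving φ μ μ) {f : Ω → ℝ} (hf : Measurable f) :
    ∫ x, f (φ x) ∂μ = ∫ x, f x ∂μ := by
  have h := integral_map (μ := μ) hφ.measurable.aemeasurable (f := f) hf.aestronglyMeasurable
  rw [hφ.map_eq] at h
  exact h.symm

/-- A function of `a` points bounded by `R` and separately Hölder with constants adding up to at
most `2 * R`. -/
structure IsBlockFunctional {M : Type*} [MetricSpace M] [MeasurableSpace M] (η : ℝ) {a : ℕ}
    (Φ : (Fin a → M) → ℝ) (R : ℝ) : Prop where
  measurable : Measurable Φ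
  abs_le : ∀ y, |Φ y| ≤ R
  holder : ∃ L : ℝ, 0 ≤ L ∧ a * L ≤ 2 * R ∧
    ∀ (i : Fin a) (y : Fin a → M) (z : M),
      |Φ y - Φ (Function.update y i z)| ≤ L * dist (y i) z ^ η

theorem IsBlockFunctional.mono {M : Type*} [MetricSpace M] [MeasurableSpace M] {η : ℝ} {a : ℕ}
    {Φ : (Fin a → M) → ℝ} {R R' : ℝ} (h : IsBlockFunctional η Φ R) (hR : R ≤ R') :
    IsBlockFunctional η Φ R' := by
  obtain ⟨L, hL0, hL, hh⟩ := h.holder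
  exact ⟨h.measurable, fun y => (h.abs_le y).trans hR, L, hL0, by linarith, hh⟩

/-- A block functional evaluated along an orbit segment. -/
def alongOrbit {M : Type*} (T : M → M) {a : ℕ} (Φ : (Fin a → M) → ℝ) (x : M) : ℝ :=
  Φ fun i => T^[i] x

theorem abs_sub_update_append_le {M : Type*} [MetricSpace M] {η : ℝ} {a : ℕ} {Φ : (Fin a → M) → ℝ}
    {L : ℝ}
    (hL : ∀ (i : Fin a) (y : Fin a → M) (z : M),
      |Φ y - Φ (Function.update y i z)| ≤ L * dist (y i) z ^ η)
    (i : Fin (a + a)) (y : Fin (a + a) → M) (z : M) :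
    |(Φ (fun k => y (Fin.castAdd a k)) + Φ (fun k => y (Fin.natAdd a k))) -
        (Φ (fun k => Function.update y i z (Fin.castAdd a k)) +
          Φ (fun k => Function.update y i z (Fin.natAdd a k)))| ≤ L * dist (y i) z ^ η := by
  refine Fin.addCases (fun i => ?_) (fun i => ?_) i
  · have h1 : (fun k => Function.update y (Fin.castAdd a i) z (Fin.castAdd a k)) =
        Function.update (fun k => y (Fin.castAdd a k)) i z :=
      Function.update_comp_eq_of_injective y (Fin.castAdd_injective a a) i z
    have h2 : (fun k => Function.update y (Fin.castAdd a i) z (Fin.natAdd a k)) =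
        fun k => y (Fin.natAdd a k) := by
      funext k
      refine Function.update_of_ne ?_ _ _
      intro h
      have := congrArg Fin.val h
      simp at this
      omega
    rw [h1, h2, add_sub_add_right_eq_sub]
    exact hL i _ z
  · have h1 : (fun k => Function.update y (Fin.natAdd a i) z (Fin.natAdd a k)) =
        Function.update (fun k => y (Fin.natAdd a k)) i z :=
      Function.update_comp_eq_of_injective y (Fin.natAdd_injective a a) i z
    have h2 : (fun k => Function.update y (Fin.natAdd a i) z (Fin.castAdd a k)) =
        fun k => y (Fin.castAdd a k) := by
      funext k
      refine Function.update_of_ne ?_ _ _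
      intro h
      have := congrArg Fin.val h
      simp at this
      omega
    rw [h1, h2, add_sub_add_left_eq_sub]
    exact hL i _ z

section Dynamics

variable {M : Type*} [MetricSpace M] [MeasurableSpace M] {μ : Measure M} {T : M → M} {η γ : ℝ}

theorem IsBlockFunctional.bddMeasurable_alongOrbit {a : ℕ} {Φ : (Fin a → M) → ℝ} {R : ℝ}
    (h : IsBlockFunctional η Φ R) (hT : Measurable T) : BddMeasurable (alongOrbit T Φ) :=
  ⟨h.measurable.comp (measurable_pi_lambda _ fun i => hT.iterate i), R, fun _ => h.abs_le _⟩

/-- Two copies of a block functional, separated by a gap `g` along the orbit, behave like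
independent copies up to an error of order `(g + 1) ^ (-γ)`. -/
theorem exists_decoupling_bound [IsProbabilityMeasure μ] (hT : MeasurePreserving T μ μ)
    (hFCB : FunctionalCorrelationBound μ T η γ) {s : ℝ} (hs : 1 ≤ s) :
    ∃ C : ℝ, 0 ≤ C ∧ ∀ (a g : ℕ), 0 < a → ∀ (Φ : (Fin a → M) → ℝ) (R : ℝ),
      IsBlockFunctional η Φ R → ∀ c : ℝ, |c| ≤ 2 * R →
      |(∫ x, |alongOrbit T Φ x + alongOrbit T Φ (T^[a + g] x) + c| ^ s ∂μ) -
          ∫ x, ∫ y, |alongOrbit T Φ x + alongOrbit T Φ y + c| ^ s ∂μ ∂μ| ≤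
        C * ((g : ℝ) + 1) ^ (-γ) * R ^ s := by
  obtain ⟨C₀, hC₀, hFCB⟩ := hFCB
  have hs0 : 0 ≤ s := by linarith
  refine ⟨C₀ * ((1 + s) * 4 ^ s), by positivity, fun a g ha Φ R hΦ c hc => ?_⟩
  obtain ⟨L, hL0, hLR, hL⟩ := hΦ.holder
  have hR : 0 ≤ R := by linarith [abs_nonneg c]
  obtain ⟨n, hn⟩ : ∃ n : ℕ → ℕ, n = fun k => if k < a then k else k + g := ⟨_, rfl⟩
  have hmono : Monotone n := by
    intro i j hij
    rw [hn]
    dsimp only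
    split_ifs <;> omega
  have hna : n a = a + g := by simp [hn]
  have hna1 : n (a - 1) = a - 1 := by rw [hn]; exact if_pos (by omega)
  obtain ⟨Q, hQ⟩ : ∃ Q : (Fin (a + a) → M) → ℝ, Q = fun y =>
    Φ (fun k => y (Fin.castAdd a k)) + Φ (fun k => y (Fin.natAdd a k)) := ⟨_, rfl⟩
  have hQm : Measurable Q := by
    rw [hQ]
    exact (hΦ.measurable.comp (measurable_pi_lambda _ fun k => measurable_pi_apply _)).add
      (hΦ.measurable.comp (measurable_pi_lambda _ fun k => measurable_pi_apply _))
  have hQb : ∀ y, |Q y + c| ≤ 4 * R := by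
    intro y
    have h1 := abs_add_le (Q y) c
    have h2 : |Q y| ≤ R + R := by
      rw [hQ]; exact (abs_add_le _ _).trans (add_le_add (hΦ.abs_le _) (hΦ.abs_le _))
    linarith
  have h := hFCB (a + a) a (by omega) n hmono (by omega) (fun y => |Q y + c| ^ s)
    ((measurable_abs.comp (hQm.add_const c)).pow_const s) ((4 * R) ^ s) (by positivity)
    (fun y => by
      rw [abs_of_nonneg (by positivity)]
      exact Real.rpow_le_rpow (abs_nonneg _) (hQb y) hs0)
    (fun _ => s * (4 * R) ^ (s - 1) * L) (fun _ => by positivity)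
    (fun i y z => by
      refine (abs_rpow_abs_sub_le hs (hQb y) (hQb _)).trans ?_
      rw [mul_assoc _ L]
      refine mul_le_mul_of_nonneg_left ?_ (by positivity)
      rw [add_sub_add_right_eq_sub, hQ]
      exact abs_sub_update_append_le hL i y z)
  have horb : ∀ x, Q (fun i => T^[n i] x) =
      alongOrbit T Φ x + alongOrbit T Φ (T^[a + g] x) := by
    intro x
    rw [hQ]
    simp only [alongOrbit, hn, Fin.val_castAdd, Fin.is_lt, if_true, Fin.val_natAdd]
    congr 2
    funext k
    rw [if_neg (by omega), ← Function.iterate_add_apply]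
    congr 1; omega
  have hsplit : ∀ x₀ x₁, Q (fun i => if (i : ℕ) < a then T^[n i] x₀ else T^[n i] x₁) =
      alongOrbit T Φ x₀ + alongOrbit T Φ (T^[a + g] x₁) := by
    intro x₀ x₁
    rw [hQ]
    simp only [alongOrbit, hn, Fin.val_castAdd, Fin.is_lt, if_true, Fin.val_natAdd]
    congr 2
    funext k
    rw [if_neg (by omega), if_neg (by omega), ← Function.iterate_add_apply]
    congr 1; omega
  have hX := hΦ.bddMeasurable_alongOrbit hT.measurable
  have hstat : ∀ x₀, ∫ x₁, |alongOrbit T Φ x₀ + alongOrbit T Φ (T^[a + g] x₁) + c| ^ s ∂μ =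
      ∫ x₁, |alongOrbit T Φ x₀ + alongOrbit T Φ x₁ + c| ^ s ∂μ := fun x₀ =>
    integral_comp_measurePreserving (hT.iterate (a + g))
      (((((BddMeasurable.const _).add hX).add (.const c)).abs_rpow hs0).1)
  simp only [horb, hsplit, hstat] at h
  refine h.trans ?_
  have hgap : ((n a : ℝ) - (n (a - 1) : ℝ)) = g + 1 := by
    rw [hna, hna1, Nat.cast_sub (by omega : 1 ≤ a)]; push_cast; ring
  rw [hgap]
  have hsum : (4 * R) ^ s + ∑ _i : Fin (a + a), s * (4 * R) ^ (s - 1) * L ≤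
      (1 + s) * 4 ^ s * R ^ s := by
    rw [Finset.sum_const, Finset.card_univ, Fintype.card_fin, nsmul_eq_mul, mul_assoc (1 + s),
      ← Real.mul_rpow (by norm_num) hR]
    have h1 : ((a + a : ℕ) : ℝ) * (s * (4 * R) ^ (s - 1) * L) =
        s * (4 * R) ^ (s - 1) * (2 * (a * L)) := by push_cast; ring
    have h2 : s * (4 * R) ^ (s - 1) * (2 * (a * L)) ≤ s * (4 * R) ^ (s - 1) * (4 * R) := by
      refine mul_le_mul_of_nonneg_left (by linarith) (by positivity)
    have h3 : (4 * R) ^ (s - 1) * (4 * R) ≤ (4 * R) ^ s := by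
      rcases hR.eq_or_lt with h0 | h0
      · rw [← h0]; simp; positivity
      · rw [← Real.rpow_add_one (by positivity)]; simp
    have h4 := mul_le_mul_of_nonneg_left h3 hs0
    rw [h1]
    linarith
  calc _ ≤ C₀ * ((g : ℝ) + 1) ^ (-γ) * ((1 + s) * 4 ^ s * R ^ s) := by gcongr
    _ = _ := by ring

/-- The decoupling error for gaps comparable to the total length. -/
theorem exists_decoupling_error [IsProbabilityMeasure μ] (hT : MeasurePreserving T μ μ)
    (hγ : 0 ≤ γ) (hFCB : FunctionalCorrelationBound μ T η γ) {s κ ρ : ℝ} (hs : 1 ≤ s)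
    (hρ : ρ * s - γ ≤ κ * s) (K : ℕ) :
    ∃ C : ℝ, 0 ≤ C ∧ ∀ (a g : ℕ), 0 < a → ((2 * a + g : ℕ) : ℝ) ≤ K * g →
      ∀ (Φ : (Fin a → M) → ℝ), IsBlockFunctional η Φ (((2 * a + g : ℕ) : ℝ) ^ ρ) →
      ∀ c : ℝ, |c| ≤ 2 * ((2 * a + g : ℕ) : ℝ) ^ ρ →
      ∫ x, |alongOrbit T Φ x + alongOrbit T Φ (T^[a + g] x) + c| ^ s ∂μ ≤
        ∫ x, ∫ y, |alongOrbit T Φ x + alongOrbit T Φ y + c| ^ s ∂μ ∂μ +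
          C * (((2 * a + g : ℕ) : ℝ) ^ κ) ^ s := by
  obtain ⟨C, hC, h⟩ := exists_decoupling_bound hT hFCB hs
  refine ⟨C * (K : ℝ) ^ γ, by positivity, fun a g ha hK Φ hΦ c hc => ?_⟩
  have h1 := (le_abs_self _).trans (h a g ha Φ _ hΦ c hc)
  obtain ⟨N, hN⟩ : ∃ N : ℝ, N = ((2 * a + g : ℕ) : ℝ) := ⟨_, rfl⟩
  rw [← hN] at h1 hK ⊢
  have hN1 : 1 ≤ N := by
    rw [hN]; exact_mod_cast (by omega : 1 ≤ 2 * a + g)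
  have hN0 : 0 < N := by linarith
  have hK0 : (0 : ℝ) ≤ K := Nat.cast_nonneg K
  have hg0 : (0 : ℝ) ≤ g := Nat.cast_nonneg g
  have h2 : ((g : ℝ) + 1) ^ (-γ) ≤ (K : ℝ) ^ γ * N ^ (-γ) := by
    rw [Real.rpow_neg (by positivity), Real.rpow_neg hN0.le, ← div_eq_mul_inv,
      inv_le_comm₀ (by positivity) (by
        have : 0 < (K : ℝ) := by
          rcases hK0.eq_or_lt with h0 | h0
          · rw [← h0] at hK; linarith
          · exact h0
        positivity), inv_div, div_le_iff₀ (by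
        have : 0 < (K : ℝ) := by
          rcases hK0.eq_or_lt with h0 | h0
          · rw [← h0] at hK; linarith
          · exact h0
        positivity), ← Real.mul_rpow (by positivity) hK0]
    exact Real.rpow_le_rpow hN0.le (by nlinarith) hγ
  have h3 : N ^ (-γ) * (N ^ ρ) ^ s ≤ (N ^ κ) ^ s := by
    rw [← Real.rpow_mul hN0.le, ← Real.rpow_mul hN0.le, ← Real.rpow_add hN0]
    exact Real.rpow_le_rpow_of_exponent_le hN1 (by linarith)
  have h4 : C * ((g : ℝ) + 1) ^ (-γ) * (N ^ ρ) ^ s ≤ C * (K : ℝ) ^ γ * (N ^ κ) ^ s := by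
    calc C * ((g : ℝ) + 1) ^ (-γ) * (N ^ ρ) ^ s
        ≤ C * ((K : ℝ) ^ γ * N ^ (-γ)) * (N ^ ρ) ^ s := by gcongr
      _ = C * (K : ℝ) ^ γ * (N ^ (-γ) * (N ^ ρ) ^ s) := by ring
      _ ≤ _ := by gcongr
  linarith

theorem le_add_of_rpow_le {s θ A B C x : ℝ} (hs : 1 ≤ s) (hθ : 0 ≤ θ) (hA : 0 ≤ A) (hB : 0 ≤ B)
    (hC : 0 ≤ C) (h : x ≤ θ ^ s * A ^ s + C * B ^ s) : x ≤ (θ * A + C ^ s⁻¹ * B) ^ s := by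
  have hCs : (C ^ s⁻¹) ^ s = C := Real.rpow_inv_rpow hC (by linarith)
  have h1 := Real.add_rpow_le_rpow_add (a := θ * A) (b := C ^ s⁻¹ * B) (by positivity)
    (by positivity) hs
  rw [Real.mul_rpow hθ hA, Real.mul_rpow (by positivity) hB, hCs] at h1
  exact h.trans h1

theorem exists_lpNorm_two_blocks_le [IsProbabilityMeasure μ] (hT : MeasurePreserving T μ μ)
    (hγ : 0 ≤ γ) (hFCB : FunctionalCorrelationBound μ T η γ) {s κ ρ θ c : ℝ} (hs : 1 ≤ s)
    (hρ : ρ * s - γ ≤ κ * s) (hθ0 : 0 ≤ θ) (hθ : 2 < θ ^ s) (hc : 0 ≤ c) (K : ℕ) :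
    ∃ C : ℝ, 0 ≤ C ∧ ∀ (a g : ℕ), 0 < a → ((2 * a + g : ℕ) : ℝ) ≤ K * g →
      ∀ (Φ : (Fin a → M) → ℝ), IsBlockFunctional η Φ (((2 * a + g : ℕ) : ℝ) ^ ρ) →
      ∫ x, |alongOrbit T Φ x| ∂μ ≤ c * ((2 * a + g : ℕ) : ℝ) ^ κ →
      lpNorm (fun x => alongOrbit T Φ x + alongOrbit T Φ (T^[a + g] x)) (ENNReal.ofReal s) μ ≤
        θ * lpNorm (alongOrbit T Φ) (ENNReal.ofReal s) μ + C * ((2 * a + g : ℕ) : ℝ) ^ κ := by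
  obtain ⟨C₁, hC₁, h₁⟩ := exists_decoupling_error hT hγ hFCB hs hρ K
  obtain ⟨C₂, hC₂, h₂⟩ := exists_integral_integral_add_rpow_le μ hs hθ hc
  refine ⟨(C₁ + C₂) ^ s⁻¹, by positivity, fun a g ha hK Φ hΦ hmean => ?_⟩
  have hN0 : (0 : ℝ) < ((2 * a + g : ℕ) : ℝ) := by exact_mod_cast (by omega : 0 < 2 * a + g)
  have hX := hΦ.bddMeasurable_alongOrbit hT.measurable
  have hs0 : 0 < s := by linarith
  have e1 := h₁ a g ha hK Φ hΦ 0 (by rw [abs_zero]; positivity)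
  have e2 := h₂ _ (by positivity) _ hX hmean
  simp only [add_zero] at e1
  refine lpNorm_le_of_integral_le hs0 (hX.add (hX.comp (hT.iterate _).measurable))
    (add_nonneg (mul_nonneg hθ0 lpNorm_nonneg) (by positivity)) ?_
  refine le_add_of_rpow_le hs hθ0 lpNorm_nonneg (by positivity) (by positivity) ?_
  rw [lpNorm_rpow_eq_integral hs0 hX]
  linarith

/-- The `L^s` norm of `X x - X y` for independent `x`, `y`. -/
noncomputable def symmetrisedNorm (μ : Measure M) (s : ℝ) (X : M → ℝ) : ℝ :=
  lpNorm (fun z : M × M => X z.2 - X z.1) (ENNReal.ofReal s) (μ.prod μ)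

theorem exists_symmetrisedNorm_two_blocks_le [IsProbabilityMeasure μ]
    (hT : MeasurePreserving T μ μ) (hγ : 0 ≤ γ) (hFCB : FunctionalCorrelationBound μ T η γ)
    {s κ ρ : ℝ} (hs : 1 ≤ s) (hs2 : s ≤ 2) (hρ : ρ * s - γ ≤ κ * s) (K : ℕ) :
    ∃ C : ℝ, 0 ≤ C ∧ ∀ (a g : ℕ), 0 < a → ((2 * a + g : ℕ) : ℝ) ≤ K * g →
      ∀ (Φ : (Fin a → M) → ℝ), IsBlockFunctional η Φ (((2 * a + g : ℕ) : ℝ) ^ ρ) →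
      symmetrisedNorm μ s (fun x => alongOrbit T Φ x + alongOrbit T Φ (T^[a + g] x)) ≤
        2 ^ s⁻¹ * symmetrisedNorm μ s (alongOrbit T Φ) + C * ((2 * a + g : ℕ) : ℝ) ^ κ := by
  obtain ⟨C₁, hC₁, h₁⟩ := exists_decoupling_error hT hγ hFCB hs hρ K
  refine ⟨(2 * C₁) ^ s⁻¹, by positivity, fun a g ha hK Φ hΦ => ?_⟩
  have hN0 : (0 : ℝ) < ((2 * a + g : ℕ) : ℝ) := by exact_mod_cast (by omega : 0 < 2 * a + g)
  have hX := hΦ.bddMeasurable_alongOrbit hT.measurable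
  have hs0 : 0 < s := by linarith
  have hsub : ∀ {Y : M → ℝ}, BddMeasurable Y →
      BddMeasurable (fun z : M × M => Y z.2 - Y z.1) := fun hY =>
    (hY.comp measurable_snd).sub (hY.comp measurable_fst)
  have hXX := hX.add (hX.comp (hT.iterate (a + g)).measurable)
  have e := integral_integral_symmetrised_rpow_le (μ := μ) hs hs2 hX
    (hT.iterate (a + g)).measurable (fun x => hΦ.abs_le _)
    (h₁ a g ha hK Φ hΦ)
  rw [← integral_prod (fun z : M × M => |(alongOrbit T Φ z.2 + alongOrbit T Φ (T^[a + g] z.2)) -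
      (alongOrbit T Φ z.1 + alongOrbit T Φ (T^[a + g] z.1))| ^ s)
      (((hsub hXX).abs_rpow hs0.le).integrable _),
    ← integral_prod (fun z : M × M => |alongOrbit T Φ z.2 - alongOrbit T Φ z.1| ^ s)
      (((hsub hX).abs_rpow hs0.le).integrable _)] at e
  refine lpNorm_le_of_integral_le hs0 (hsub hXX)
    (add_nonneg (mul_nonneg (by positivity) lpNorm_nonneg) (by positivity)) ?_
  refine le_add_of_rpow_le hs (by positivity) lpNorm_nonneg (by positivity) (by positivity) ?_
  rw [symmetrisedNorm, lpNorm_rpow_eq_integral hs0 (hsub hX),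
    Real.rpow_inv_rpow (by norm_num) hs0.ne']
  linarith

end Dynamics

/-! ### Birkhoff sums and iterated sums -/

/-- `∑_{0 ≤ i < j < n} v ∘ T^i * w ∘ T^j`. -/
def iteratedSum {M : Type*} (T : M → M) (v w : M → ℝ) (n : ℕ) (x : M) : ℝ :=
  ∑ j ∈ Finset.range n, ∑ i ∈ Finset.range j, v (T^[i] x) * w (T^[j] x)

theorem iteratedSum_eq_sum_birkhoffSum {M : Type*} (T : M → M) (v w : M → ℝ) (n : ℕ) (x : M) :
    iteratedSum T v w n x = ∑ j ∈ Finset.range n, birkhoffSum T v j x * w (T^[j] x) := by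
  simp only [iteratedSum, birkhoffSum, Finset.sum_mul]

theorem iteratedSum_add {M : Type*} (T : M → M) (v w : M → ℝ) (m k : ℕ) (x : M) :
    iteratedSum T v w (m + k) x = iteratedSum T v w m x + iteratedSum T v w k (T^[m] x) +
      birkhoffSum T v m x * birkhoffSum T w k (T^[m] x) := by
  have h : ∀ j, birkhoffSum T v (m + j) x * w (T^[m + j] x) =
      birkhoffSum T v m x * w (T^[j] (T^[m] x)) +
        birkhoffSum T v j (T^[m] x) * w (T^[j] (T^[m] x)) := by
    intro j
    rw [birkhoffSum_add, add_comm m j, Function.iterate_add_apply]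
    ring
  simp only [iteratedSum_eq_sum_birkhoffSum, Finset.sum_range_add, h, Finset.sum_add_distrib]
  rw [← Finset.mul_sum]
  simp only [birkhoffSum]
  ring

theorem birkhoffSum_two_mul_add {M : Type*} (T : M → M) (v : M → ℝ) (a g : ℕ) (x : M) :
    birkhoffSum T v (2 * a + g) x =
      (birkhoffSum T v a x + birkhoffSum T v a (T^[a + g] x)) +
        birkhoffSum T v g (T^[a] x) := by
  rw [show 2 * a + g = a + (g + a) by ring, birkhoffSum_add, birkhoffSum_add,
    ← Function.iterate_add_apply, add_comm g a]
  ring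

theorem iteratedSum_two_mul_add {M : Type*} (T : M → M) (v w : M → ℝ) (a g : ℕ) (x : M) :
    iteratedSum T v w (2 * a + g) x =
      (iteratedSum T v w a x + iteratedSum T v w a (T^[a + g] x)) +
        (iteratedSum T v w g (T^[a] x) +
          (birkhoffSum T v a x * birkhoffSum T w (g + a) (T^[a] x) +
            birkhoffSum T v g (T^[a] x) * birkhoffSum T w a (T^[a + g] x))) := by
  rw [show 2 * a + g = a + (g + a) by ring, iteratedSum_add, iteratedSum_add,
    ← Function.iterate_add_apply, add_comm g a]
  ring

theorem birkhoffSum_sq {M : Type*} (T : M → M) (v : M → ℝ) (n : ℕ) (x : M) :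
    birkhoffSum T v n x ^ 2 =
      ∑ i ∈ Finset.range n, v (T^[i] x) ^ 2 + 2 * iteratedSum T v v n x := by
  simp only [iteratedSum_eq_sum_birkhoffSum]
  induction n with
  | zero => simp
  | succ n ih =>
    rw [birkhoffSum_succ, Finset.sum_range_succ, Finset.sum_range_succ]
    linear_combination ih

theorem abs_birkhoffSum_le {M : Type*} (T : M → M) {v : M → ℝ} (hv : ∀ x, |v x| ≤ 1) (n : ℕ)
    (x : M) : |birkhoffSum T v n x| ≤ n := by
  refine (Finset.abs_sum_le_sum_abs _ _).trans ?_
  refine (Finset.sum_le_card_nsmul _ _ 1 fun i _ => hv _).trans ?_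
  simp

theorem abs_iteratedSum_le {M : Type*} (T : M → M) {v w : M → ℝ} (hv : ∀ x, |v x| ≤ 1)
    (hw : ∀ x, |w x| ≤ 1) (n : ℕ) (x : M) : |iteratedSum T v w n x| ≤ (n : ℝ) ^ 2 := by
  rw [iteratedSum_eq_sum_birkhoffSum]
  refine (Finset.abs_sum_le_sum_abs _ _).trans ?_
  refine (Finset.sum_le_card_nsmul _ _ (n : ℝ) fun j hj => ?_).trans ?_
  · rw [abs_mul]
    have h1 := abs_birkhoffSum_le T hv j x
    have h2 : (j : ℝ) ≤ n := by exact_mod_cast (Finset.mem_range.1 hj).le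
    nlinarith [hw (T^[j] x), abs_nonneg (w (T^[j] x)), abs_nonneg (birkhoffSum T v j x)]
  · simp [sq]

/-- Mean-zero observables with sup norm and Hölder seminorm at most one. -/
structure IsNormalised {M : Type*} [MetricSpace M] [MeasurableSpace M] (μ : Measure M) (η : ℝ)
    (v : M → ℝ) : Prop where
  abs_le : ∀ x, |v x| ≤ 1
  holder : ∀ x y, |v x - v y| ≤ dist x y ^ η
  integral_eq : ∫ x, v x ∂μ = 0

theorem measurable_of_abs_sub_le_dist_rpow {M : Type*} [MetricSpace M] [MeasurableSpace M]
    [BorelSpace M] {η : ℝ} (hη : 0 < η) {v : M → ℝ} (h : ∀ x y, |v x - v y| ≤ dist x y ^ η) :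
    Measurable v := by
  refine Continuous.measurable (continuous_iff_continuousAt.2 fun y => ?_)
  refine tendsto_iff_dist_tendsto_zero.2 ?_
  have h0 : Filter.Tendsto (fun x => dist x y ^ η) (nhds y) (nhds 0) := by
    have : Continuous fun x => dist x y ^ η :=
      (continuous_id.dist continuous_const).rpow_const fun _ => Or.inr hη.le
    have := this.tendsto y
    rwa [dist_self, Real.zero_rpow hη.ne'] at this
  exact squeeze_zero (fun _ => dist_nonneg) (fun x => h x y) h0

theorem IsNormalised.bddMeasurable {M : Type*} [MetricSpace M] [MeasurableSpace M]
    [BorelSpace M] {μ : Measure M} {η : ℝ} (hη : 0 < η) {v : M → ℝ} (h : IsNormalised μ η v) :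
    BddMeasurable v :=
  ⟨measurable_of_abs_sub_le_dist_rpow hη h.holder, 1, h.abs_le⟩

theorem BddMeasurable.birkhoffSum {M : Type*} [MeasurableSpace M] {T : M → M} {v : M → ℝ}
    (hv : BddMeasurable v) (hT : Measurable T) (n : ℕ) : BddMeasurable (birkhoffSum T v n) :=
  BddMeasurable.sum _ fun i => hv.comp (hT.iterate i)

theorem BddMeasurable.iteratedSum {M : Type*} [MeasurableSpace M] {T : M → M} {v w : M → ℝ}
    (hv : BddMeasurable v) (hw : BddMeasurable w) (hT : Measurable T) (n : ℕ) :
    BddMeasurable (iteratedSum T v w n) :=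
  BddMeasurable.sum _ fun j => BddMeasurable.sum _ fun i =>
    (hv.comp (hT.iterate i)).mul (hw.comp (hT.iterate j))

theorem abs_sub_update_le {M : Type*} [MetricSpace M] {η : ℝ} {v : M → ℝ}
    (h : ∀ x y, |v x - v y| ≤ dist x y ^ η) {a : ℕ} (k : Fin a) (y : Fin a → M) (z : M)
    (i : Fin a) :
    |v (y i) - v (Function.update y k z i)| ≤ if i = k then dist (y k) z ^ η else 0 := by
  split_ifs with hi
  · subst hi
    simpa using h (y i) z
  · rw [Function.update_of_ne hi]
    simp

theorem isBlockFunctional_sum {M : Type*} [MetricSpace M] [MeasurableSpace M] {η : ℝ}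
    {v : M → ℝ} (hvm : Measurable v) (hv : ∀ x, |v x| ≤ 1)
    (hvh : ∀ x y, |v x - v y| ≤ dist x y ^ η) (a : ℕ) :
    IsBlockFunctional η (fun y : Fin a → M => ∑ i, v (y i)) a where
  measurable := Finset.measurable_fun_sum _ fun i _ => hvm.comp (measurable_pi_apply i)
  abs_le y := by
    refine (Finset.abs_sum_le_sum_abs _ _).trans ?_
    refine (Finset.sum_le_card_nsmul _ _ 1 fun i _ => hv _).trans ?_
    simp
  holder := by
    refine ⟨1, zero_le_one, by linarith [(Nat.cast_nonneg a : (0 : ℝ) ≤ a)], fun k y z => ?_⟩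
    rw [← Finset.sum_sub_distrib, one_mul]
    refine (Finset.abs_sum_le_sum_abs _ _).trans ?_
    refine (Finset.sum_le_sum fun i _ => abs_sub_update_le hvh k y z i).trans ?_
    simp

theorem isBlockFunctional_sum_sum {M : Type*} [MetricSpace M] [MeasurableSpace M] {η : ℝ}
    {v w : M → ℝ} (hvm : Measurable v) (hv : ∀ x, |v x| ≤ 1)
    (hvh : ∀ x y, |v x - v y| ≤ dist x y ^ η) (hwm : Measurable w) (hw : ∀ x, |w x| ≤ 1)
    (hwh : ∀ x y, |w x - w y| ≤ dist x y ^ η) (a : ℕ) :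
    IsBlockFunctional η
      (fun y : Fin a → M => ∑ j, ∑ i, if i < j then v (y i) * w (y j) else 0)
      ((a : ℝ) ^ 2) where
  measurable := Finset.measurable_fun_sum _ fun j _ => Finset.measurable_fun_sum _ fun i _ => by
    split_ifs
    · exact (hvm.comp (measurable_pi_apply i)).mul (hwm.comp (measurable_pi_apply j))
    · exact measurable_const
  abs_le y := by
    refine (Finset.abs_sum_le_sum_abs _ _).trans ?_
    have h : ∀ j ∈ Finset.univ, |∑ i, if i < j then v (y i) * w (y j) else 0| ≤ (a : ℝ) := by
      intro j _
      refine (Finset.abs_sum_le_sum_abs _ _).trans ?_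
      refine (Finset.sum_le_card_nsmul _ _ 1 fun i _ => ?_).trans (by simp)
      split_ifs
      · rw [abs_mul]
        exact mul_le_one₀ (hv _) (abs_nonneg _) (hw _)
      · simp
    refine (Finset.sum_le_card_nsmul _ _ _ h).trans ?_
    simp [sq]
  holder := by
    refine ⟨2 * a, by positivity, by rw [sq]; linarith, fun k y z => ?_⟩
    obtain ⟨δ, hδ⟩ : ∃ δ : ℝ, δ = dist (y k) z ^ η := ⟨_, rfl⟩
    have hδ0 : 0 ≤ δ := by rw [hδ]; positivity
    have hterm : ∀ i j : Fin a, |(if i < j then v (y i) * w (y j) else 0) -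
        (if i < j then v (Function.update y k z i) * w (Function.update y k z j) else 0)| ≤
        (if i = k then δ else 0) + if j = k then δ else 0 := by
      intro i j
      have h1 := abs_sub_update_le hvh k y z i
      have h2 := abs_sub_update_le hwh k y z j
      rw [← hδ] at h1 h2
      by_cases hij : i < j
      · rw [if_pos hij, if_pos hij]
        refine le_trans ?_ (add_le_add h1 h2)
        rw [show v (y i) * w (y j) - v (Function.update y k z i) * w (Function.update y k z j) =
          (v (y i) - v (Function.update y k z i)) * w (y j) +
            v (Function.update y k z i) * (w (y j) - w (Function.update y k z j)) by ring]
        refine (abs_add_le _ _).trans ?_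
        rw [abs_mul, abs_mul]
        exact add_le_add (mul_le_of_le_one_right (abs_nonneg _) (hw _))
          (mul_le_of_le_one_left (abs_nonneg _) (hv _))
      · rw [if_neg hij, if_neg hij, sub_self, abs_zero]
        split_ifs <;> linarith
    rw [← hδ, ← Finset.sum_sub_distrib]
    simp only [← Finset.sum_sub_distrib]
    refine (Finset.abs_sum_le_sum_abs _ _).trans ?_
    refine (Finset.sum_le_sum fun j _ => (Finset.abs_sum_le_sum_abs _ _).trans
      (Finset.sum_le_sum fun i _ => hterm i j)).trans ?_
    simp only [Finset.sum_add_distrib, Finset.sum_ite_eq', Finset.mem_univ, if_true,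
      Finset.sum_const, Finset.card_univ, Fintype.card_fin, nsmul_eq_mul]
    rw [← Finset.mul_sum]
    simp
    linarith

theorem alongOrbit_sum {M : Type*} (T : M → M) (v : M → ℝ) (a : ℕ) :
    alongOrbit T (fun y : Fin a → M => ∑ i, v (y i)) = birkhoffSum T v a := by
  funext x
  exact Fin.sum_univ_eq_sum_range (fun i => v (T^[i] x)) a

theorem alongOrbit_sum_sum {M : Type*} (T : M → M) (v w : M → ℝ) (a : ℕ) :
    alongOrbit T (fun y : Fin a → M => ∑ j, ∑ i, if i < j then v (y i) * w (y j) else 0) =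
      iteratedSum T v w a := by
  funext x
  have h : ∀ j : Fin a, ∑ i : Fin a, (if i < j then v (T^[i] x) * w (T^[j] x) else 0) =
      ∑ i ∈ Finset.range j, v (T^[i] x) * w (T^[j] x) := by
    intro j
    have := Fin.sum_univ_eq_sum_range
      (fun i => if i < (j : ℕ) then v (T^[i] x) * w (T^[j] x) else 0) a
    simp only [Fin.lt_def]
    rw [this, ← Finset.sum_filter]
    congr 1
    ext i
    simp only [Finset.mem_filter, Finset.mem_range]
    omega
  simp only [alongOrbit, h, iteratedSum]
  exact Fin.sum_univ_eq_sum_range (fun j => ∑ i ∈ Finset.range j, v (T^[i] x) * w (T^[j] x)) a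

/-! ### First moments -/

section Correlations

variable {M : Type*} [MetricSpace M] [MeasurableSpace M] [BorelSpace M] {μ : Measure M}
  {T : M → M} {η γ : ℝ}

theorem exists_abs_integral_mul_le (hT : MeasurePreserving T μ μ) (hη : 0 < η)
    (hFCB : FunctionalCorrelationBound μ T η γ) :
    ∃ C : ℝ, 0 ≤ C ∧ ∀ v w : M → ℝ, IsNormalised μ η v → IsNormalised μ η w →
      ∀ i j : ℕ, i < j →
        |∫ x, v (T^[i] x) * w (T^[j] x) ∂μ| ≤ C * ((j : ℝ) - i) ^ (-γ) := by
  obtain ⟨C₀, hC₀, hFCB⟩ := hFCB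
  refine ⟨3 * C₀, by positivity, fun v w hv hw i j hij => ?_⟩
  have hvm := hv.bddMeasurable hη
  have hwm := hw.bddMeasurable hη
  have h := hFCB 2 1 (by norm_num) (fun k => if k = 0 then i else j)
    (by
      intro k l hkl
      dsimp only
      split_ifs <;> omega)
    (by simpa using hij) (fun y => v (y 0) * w (y 1))
    ((hvm.1.comp (measurable_pi_apply 0)).mul (hwm.1.comp (measurable_pi_apply 1)))
    1 zero_le_one
    (fun y => by
      rw [abs_mul]
      exact mul_le_one₀ (hv.abs_le _) (abs_nonneg _) (hw.abs_le _))
    (fun _ => 1) (fun _ => zero_le_one)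
    (fun k y z => by
      rw [one_mul]
      fin_cases k
      · simp only [Fin.zero_eta, Function.update_self]
        rw [Function.update_of_ne (by decide), ← sub_mul, abs_mul]
        exact (mul_le_of_le_one_right (abs_nonneg _) (hw.abs_le _)).trans (hv.holder _ _)
      · simp only [Fin.mk_one, Function.update_self]
        rw [Function.update_of_ne (by decide), ← mul_sub, abs_mul]
        exact (mul_le_of_le_one_left (abs_nonneg _) (hv.abs_le _)).trans (hw.holder _ _))
  have hzero : ∫ x, w (T^[j] x) ∂μ = 0 := by
    rw [integral_comp_measurePreserving (hT.iterate j) hwm.1, hw.integral_eq]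
  simp [integral_const_mul, hzero] at h
  linarith

theorem exists_abs_integral_iteratedSum_le [IsProbabilityMeasure μ]
    (hT : MeasurePreserving T μ μ) (hη : 0 < η) (hγ : 1 < γ)
    (hFCB : FunctionalCorrelationBound μ T η γ) :
    ∃ C : ℝ, 0 ≤ C ∧ ∀ v w : M → ℝ, IsNormalised μ η v → IsNormalised μ η w →
      ∀ n : ℕ, |∫ x, iteratedSum T v w n x ∂μ| ≤ C * n := by
  obtain ⟨C, hC, hcorr⟩ := exists_abs_integral_mul_le hT hη hFCB
  have hsum : Summable fun k : ℕ => ((k : ℝ) + 1) ^ (-γ) := by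
    have := (summable_nat_add_iff 1).2 (Real.summable_nat_rpow.2 (by linarith : -γ < -1))
    simpa using this
  refine ⟨C * ∑' k : ℕ, ((k : ℝ) + 1) ^ (-γ),
    mul_nonneg hC (tsum_nonneg fun k => by positivity), fun v w hv hw n => ?_⟩
  have hterm : ∀ i j, Integrable (fun x => v (T^[i] x) * w (T^[j] x)) μ := fun i j =>
    (((hv.bddMeasurable hη).comp (hT.iterate i).measurable).mul
      ((hw.bddMeasurable hη).comp (hT.iterate j).measurable)).integrable μ
  have hrow : ∀ j, |∑ i ∈ Finset.range j, ∫ x, v (T^[i] x) * w (T^[j] x) ∂μ| ≤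
      C * ∑' k : ℕ, ((k : ℝ) + 1) ^ (-γ) := by
    intro j
    refine (Finset.abs_sum_le_sum_abs _ _).trans ?_
    have h1 : ∀ i ∈ Finset.range j, |∫ x, v (T^[i] x) * w (T^[j] x) ∂μ| ≤
        C * (((j - 1 - i : ℕ) : ℝ) + 1) ^ (-γ) := by
      intro i hi
      have hij := Finset.mem_range.1 hi
      have h := hcorr v w hv hw i j hij
      have he : ((j - 1 - i : ℕ) : ℝ) + 1 = (j : ℝ) - i := by
        rw [Nat.sub_sub, Nat.cast_sub (by omega)]
        push_cast
        ring
      rwa [he]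
    refine (Finset.sum_le_sum h1).trans ?_
    rw [← Finset.mul_sum, Finset.sum_range_reflect (fun k : ℕ => ((k : ℝ) + 1) ^ (-γ))]
    exact mul_le_mul_of_nonneg_left (hsum.sum_le_tsum _ fun k _ => by positivity) hC
  simp only [iteratedSum]
  rw [integral_finsetSum _ fun j _ => integrable_finsetSum _ fun i _ => hterm i j]
  simp only [integral_finsetSum _ fun i _ => hterm i _]
  refine (Finset.abs_sum_le_sum_abs _ _).trans ?_
  refine (Finset.sum_le_card_nsmul _ _ _ fun j _ => hrow j).trans ?_
  rw [Finset.card_range, nsmul_eq_mul, mul_comm]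

theorem exists_integral_abs_birkhoffSum_le [IsProbabilityMeasure μ]
    (hT : MeasurePreserving T μ μ) (hη : 0 < η) (hγ : 1 < γ)
    (hFCB : FunctionalCorrelationBound μ T η γ) :
    ∃ C : ℝ, 0 ≤ C ∧ ∀ v : M → ℝ, IsNormalised μ η v →
      ∀ n : ℕ, ∫ x, |birkhoffSum T v n x| ∂μ ≤ C * (n : ℝ) ^ (1 / 2 : ℝ) := by
  obtain ⟨C, hC, hS⟩ := exists_abs_integral_iteratedSum_le hT hη hγ hFCB
  refine ⟨(1 + 2 * C) ^ (1 / 2 : ℝ), by positivity, fun v hv n => ?_⟩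
  have hvm := hv.bddMeasurable hη
  have hV := hvm.birkhoffSum hT.measurable n
  have hSb := hvm.iteratedSum hvm hT.measurable n
  refine (integral_abs_le_lpNorm (s := 2) (by norm_num) hV).trans ?_
  refine lpNorm_le_of_integral_le (by norm_num) hV (by positivity) ?_
  rw [← Real.mul_rpow (by positivity) (by positivity), ← Real.rpow_mul (by positivity)]
  norm_num
  have h1 : ∀ x, birkhoffSum T v n x ^ 2 ≤ n + 2 * iteratedSum T v v n x := by
    intro x
    rw [birkhoffSum_sq]
    refine add_le_add ?_ le_rfl
    refine (Finset.sum_le_card_nsmul _ _ 1 fun i _ => ?_).trans (by simp)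
    exact (sq_le_one_iff_abs_le_one _).2 (hv.abs_le _)
  calc ∫ x, birkhoffSum T v n x ^ 2 ∂μ
      ≤ ∫ x, (n + 2 * iteratedSum T v v n x) ∂μ := by
        refine integral_mono ?_ (integrable_const_add_mul (hSb.integrable μ) _ _) h1
        simpa only [sq] using (hV.mul hV).integrable μ
    _ = n + 2 * ∫ x, iteratedSum T v v n x ∂μ := by
        rw [integral_add (integrable_const _) ((hSb.integrable μ).const_mul _),
          integral_const_mul]
        simp
    _ ≤ _ := by
        have := (le_abs_self _).trans (hS v v hv hv n)
        linarith

/-! ### Moment bounds -/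

theorem exists_two_lt_rpow_and_lt_two_rpow {s κ : ℝ} (hs : 0 < s) (h : 1 < s * κ) :
    ∃ θ : ℝ, 0 ≤ θ ∧ 2 < θ ^ s ∧ θ < 2 ^ κ := by
  have h1 : 1 / s < κ := by rwa [div_lt_iff₀' hs]
  refine ⟨2 ^ ((1 / s + κ) / 2), by positivity, ?_,
    Real.rpow_lt_rpow_of_exponent_lt (by norm_num) (by linarith)⟩
  rw [← Real.rpow_mul (by norm_num)]
  have h2 : 1 < (1 / s + κ) / 2 * s := by
    have : (1 / s + κ) / 2 * s = (1 + s * κ) / 2 := by field_simp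
    linarith
  simpa using Real.rpow_lt_rpow_of_exponent_lt (by norm_num : (1 : ℝ) < 2) h2

theorem exists_lpNorm_birkhoffSum_le [IsProbabilityMeasure μ] (hT : MeasurePreserving T μ μ)
    (hη : 0 < η) (hγ : 1 < γ) (hFCB : FunctionalCorrelationBound μ T η γ) :
    ∃ D : ℝ, 0 < D ∧ ∀ v : M → ℝ, IsNormalised μ η v → ∀ n : ℕ,
      lpNorm (birkhoffSum T v n) (ENNReal.ofReal (2 * γ)) μ ≤ D * (n : ℝ) ^ (1 / 2 : ℝ) := by
  obtain ⟨c, hc, hmean⟩ := exists_integral_abs_birkhoffSum_le hT hη hγ hFCB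
  obtain ⟨θ, hθ0, hθ, hθ'⟩ := exists_two_lt_rpow_and_lt_two_rpow (s := 2 * γ) (κ := 1 / 2)
    (by linarith) (by linarith)
  obtain ⟨K, -, hrec⟩ := exists_bound_of_block_recursion hθ0 (by norm_num) hθ'
  obtain ⟨C, hC, hblock⟩ := exists_lpNorm_two_blocks_le (κ := 1 / 2) (ρ := 1) hT (by linarith) hFCB
    (by linarith) (by linarith) hθ0 hθ hc K
  obtain ⟨D, hD, hbound⟩ := hrec C K hC
  refine ⟨D, hD, fun v hv => ?_⟩
  have hvm := hv.bddMeasurable hη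
  have hV := hvm.birkhoffSum hT.measurable
  have hs : 1 ≤ 2 * γ := by linarith
  have htriv : ∀ N : ℕ, lpNorm (birkhoffSum T v N) (ENNReal.ofReal (2 * γ)) μ ≤ N := fun N =>
    lpNorm_le_of_abs_le (by linarith) (hV N) (by positivity)
      (abs_birkhoffSum_le T hv.abs_le N)
  refine hbound _ (by simp) (fun N hN => (htriv N).trans ?_) fun a g ha hK => ?_
  · exact_mod_cast hN.le
  have hN : (a : ℝ) ≤ ((2 * a + g : ℕ) : ℝ) := by exact_mod_cast (by omega : a ≤ 2 * a + g)
  have h := hblock a g ha hK _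
    ((isBlockFunctional_sum hvm.1 hv.abs_le hv.holder a).mono (by rwa [Real.rpow_one]))
    (by
      rw [alongOrbit_sum]
      refine (hmean v hv a).trans (mul_le_mul_of_nonneg_left ?_ hc)
      exact Real.rpow_le_rpow (by positivity) hN (by norm_num))
  rw [alongOrbit_sum] at h
  have e := lpNorm_add_le_of_bddMeasurable (μ := μ) hs
    (g := fun x => birkhoffSum T v g (T^[a] x))
    ((hV a).add ((hV a).comp (hT.iterate (a + g)).measurable))
  rw [lpNorm_comp_measurePreserving' (hV g) (hT.iterate a)] at e
  rw [funext (birkhoffSum_two_mul_add T v a g)]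
  linarith

theorem exists_iteratedSum_two_mul_add [IsProbabilityMeasure μ] (hT : MeasurePreserving T μ μ)
    (hη : 0 < η) (hγ : 1 < γ) (hFCB : FunctionalCorrelationBound μ T η γ) :
    ∃ D : ℝ, 0 ≤ D ∧ ∀ v w : M → ℝ, IsNormalised μ η v → IsNormalised μ η w → ∀ a g : ℕ,
      ∃ E : M → ℝ, BddMeasurable E ∧
        lpNorm E (ENNReal.ofReal γ) μ ≤ D * ((2 * a + g : ℕ) : ℝ) ∧
        ∀ x, iteratedSum T v w (2 * a + g) x =
          (iteratedSum T v w a x + iteratedSum T v w a (T^[a + g] x)) +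
            (iteratedSum T v w g (T^[a] x) + E x) := by
  obtain ⟨D, hD, hbound⟩ := exists_lpNorm_birkhoffSum_le hT hη hγ hFCB
  refine ⟨2 * D ^ 2, by positivity, fun v w hv hw a g => ?_⟩
  have hV := (hv.bddMeasurable hη).birkhoffSum hT.measurable
  have hW := (hw.bddMeasurable hη).birkhoffSum hT.measurable
  obtain ⟨N, hN⟩ : ∃ N : ℕ, N = 2 * a + g := ⟨_, rfl⟩
  have hle : ∀ u : M → ℝ, IsNormalised μ η u → ∀ m ≤ N,
      lpNorm (birkhoffSum T u m) (ENNReal.ofReal (2 * γ)) μ ≤ D * (N : ℝ) ^ (1 / 2 : ℝ) :=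
    fun u hu m hm => (hbound u hu m).trans (mul_le_mul_of_nonneg_left
      (Real.rpow_le_rpow (by positivity) (by exact_mod_cast hm) (by norm_num)) hD.le)
  have hsq : D * (N : ℝ) ^ (1 / 2 : ℝ) * (D * (N : ℝ) ^ (1 / 2 : ℝ)) = D ^ 2 * N := by
    rw [← Real.sqrt_eq_rpow]
    linear_combination D ^ 2 * Real.mul_self_sqrt (Nat.cast_nonneg N : (0 : ℝ) ≤ N)
  have hprod : ∀ {f h : M → ℝ}, BddMeasurable f → BddMeasurable h →
      lpNorm f (ENNReal.ofReal (2 * γ)) μ ≤ D * (N : ℝ) ^ (1 / 2 : ℝ) →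
      lpNorm h (ENNReal.ofReal (2 * γ)) μ ≤ D * (N : ℝ) ^ (1 / 2 : ℝ) →
      lpNorm (fun x => f x * h x) (ENNReal.ofReal γ) μ ≤ D ^ 2 * N := by
    intro f h hf hh h1 h2
    rw [← hsq]
    exact (lpNorm_mul_le hf hh).trans (mul_le_mul h1 h2 lpNorm_nonneg (by positivity))
  have hcV : ∀ m k, BddMeasurable fun x => birkhoffSum T v m (T^[k] x) := fun m k =>
    (hV m).comp (hT.iterate k).measurable
  have hcW : ∀ m k, BddMeasurable fun x => birkhoffSum T w m (T^[k] x) := fun m k =>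
    (hW m).comp (hT.iterate k).measurable
  refine ⟨_, ((hV a).mul (hcW (g + a) a)).add ((hcV g a).mul (hcW a (a + g))), ?_,
    fun x => iteratedSum_two_mul_add T v w a g x⟩
  rw [← hN]
  refine (lpNorm_add_le_of_bddMeasurable hγ.le ((hV a).mul (hcW (g + a) a))).trans ?_
  have h1 := hprod (hV a) (hcW (g + a) a) (hle v hv a (by omega)) (by
    rw [lpNorm_comp_measurePreserving' (hW _) (hT.iterate a)]
    exact hle w hw _ (by omega))
  have h2 := hprod (hcV g a) (hcW a (a + g))
    (by
      rw [lpNorm_comp_measurePreserving' (hV _) (hT.iterate a)]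
      exact hle v hv _ (by omega))
    (by
      rw [lpNorm_comp_measurePreserving' (hW _) (hT.iterate (a + g))]
      exact hle w hw _ (by omega))
  linarith

end Correlations

section SymmetrisedNorm

variable {M : Type*} [MeasurableSpace M] {μ : Measure M}
  [IsProbabilityMeasure μ] {s : ℝ} {X Y : M → ℝ}

theorem symmetrisedNorm_add_le (hs : 1 ≤ s) (hX : BddMeasurable X) :
    symmetrisedNorm μ s (fun x => X x + Y x) ≤ symmetrisedNorm μ s X + symmetrisedNorm μ s Y := by
  have h := lpNorm_add_le_of_bddMeasurable (μ := μ.prod μ) hs (g := fun z => Y z.2 - Y z.1)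
    ((hX.comp measurable_snd).sub (hX.comp measurable_fst))
  simpa only [symmetrisedNorm, add_sub_add_comm] using h

theorem symmetrisedNorm_comp (hX : BddMeasurable X) {φ : M → M} (hφ : MeasurePreserving φ μ μ) :
    symmetrisedNorm μ s (fun x => X (φ x)) = symmetrisedNorm μ s X :=
  lpNorm_comp_measurePreserving' (f := fun z : M × M => X z.2 - X z.1)
    ((hX.comp measurable_snd).sub (hX.comp measurable_fst)) (hφ.prod hφ) _

theorem symmetrisedNorm_le (hs : 1 ≤ s) (hX : BddMeasurable X) :
    symmetrisedNorm μ s X ≤ 2 * lpNorm X (ENNReal.ofReal s) μ := by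
  have h := lpNorm_sub_le_of_bddMeasurable (μ := μ.prod μ) hs (g := fun z => X z.1)
    (hX.comp measurable_snd)
  rw [lpNorm_comp_measurePreserving' hX measurePreserving_snd,
    lpNorm_comp_measurePreserving' hX measurePreserving_fst] at h
  rw [two_mul]
  exact h

theorem integral_abs_sub_integral_le_symmetrisedNorm (hs : 1 ≤ s) (hX : BddMeasurable X) :
    ∫ y, |X y - ∫ x, X x ∂μ| ∂μ ≤ symmetrisedNorm μ s X := by
  have hd : BddMeasurable fun z : M × M => X z.2 - X z.1 :=
    (hX.comp measurable_snd).sub (hX.comp measurable_fst)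
  refine le_trans ?_ (integral_abs_le_lpNorm hs hd)
  rw [integral_prod_symm _ (hd.abs.integrable _)]
  refine integral_mono ((hX.sub (.const _)).abs.integrable μ)
    ((hd.abs.comp measurable_swap).integral_right μ |>.integrable μ) fun y => ?_
  have h : ∫ x, (X y - X x) ∂μ = X y - ∫ x, X x ∂μ := by
    rw [integral_sub (integrable_const _) (hX.integrable μ)]
    simp
  dsimp only
  rw [← h]
  exact abs_integral_le_integral_abs

end SymmetrisedNorm

section IteratedSums

variable {M : Type*} [MetricSpace M] [MeasurableSpace M] [BorelSpace M] {μ : Measure M}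
  [IsProbabilityMeasure μ] {T : M → M} {η γ : ℝ}

theorem exists_integral_abs_iteratedSum_le (hT : MeasurePreserving T μ μ) (hη : 0 < η)
    (hγ : 1 < γ)
    (hFCB : FunctionalCorrelationBound μ T η γ) :
    ∃ C : ℝ, 0 ≤ C ∧ ∀ v w : M → ℝ, IsNormalised μ η v → IsNormalised μ η w → ∀ n : ℕ,
      ∫ x, |iteratedSum T v w n x| ∂μ ≤ C * n := by
  obtain ⟨C₁, hC₁, hmean⟩ := exists_abs_integral_iteratedSum_le hT hη hγ hFCB
  obtain ⟨C₂, hC₂, hsplit⟩ := exists_iteratedSum_two_mul_add hT hη hγ hFCB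
  obtain ⟨s, hs⟩ : ∃ s, s = min γ 2 := ⟨_, rfl⟩
  have hs1 : 1 < s := by rw [hs]; exact lt_min hγ (by norm_num)
  have hsγ : s ≤ γ := hs ▸ min_le_left _ _
  have hs2 : s ≤ 2 := hs ▸ min_le_right _ _
  have hθ : (2 : ℝ) ^ s⁻¹ < 2 ^ (1 : ℝ) :=
    Real.rpow_lt_rpow_of_exponent_lt (by norm_num) (inv_lt_one_of_one_lt₀ hs1)
  obtain ⟨K, -, hrec⟩ := exists_bound_of_block_recursion (by positivity) one_pos hθ
  obtain ⟨C, hC, hblock⟩ := exists_symmetrisedNorm_two_blocks_le (s := s) (κ := 1) (ρ := 2) hT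
    (by linarith) hFCB hs1.le hs2 (by linarith) K
  obtain ⟨D, hD, hbound⟩ := hrec (C + 2 * C₂) (2 * (K : ℝ) ^ 2) (by positivity)
  refine ⟨D + C₁, by positivity, fun v w hv hw n => ?_⟩
  have hvm := hv.bddMeasurable hη
  have hwm := hw.bddMeasurable hη
  have hS := hvm.iteratedSum hwm hT.measurable
  have htriv : ∀ N : ℕ, symmetrisedNorm μ s (iteratedSum T v w N) ≤ 2 * (N : ℝ) ^ 2 := fun N =>
    (symmetrisedNorm_le hs1.le (hS N)).trans (mul_le_mul_of_nonneg_left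
      (lpNorm_le_of_abs_le (by linarith) (hS N) (by positivity)
        (abs_iteratedSum_le T hv.abs_le hw.abs_le N)) (by norm_num))
  have hsym : symmetrisedNorm μ s (iteratedSum T v w n) ≤ D * (n : ℝ) ^ (1 : ℝ) := by
    refine hbound (fun N => symmetrisedNorm μ s (iteratedSum T v w N)) (by simpa using htriv 0)
      (fun N hN => (htriv N).trans ?_) (fun a g ha hK => ?_) n
    · have : (N : ℝ) ≤ K := by exact_mod_cast hN.le
      gcongr
    have hN : (a : ℝ) ≤ ((2 * a + g : ℕ) : ℝ) := by exact_mod_cast (by omega : a ≤ 2 * a + g)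
    obtain ⟨E, hE, hE', hsum⟩ := hsplit v w hv hw a g
    have h := hblock a g ha hK _
      ((isBlockFunctional_sum_sum hvm.1 hv.abs_le hv.holder hwm.1 hw.abs_le hw.holder a).mono
        (by rw [Real.rpow_two]; gcongr))
    rw [alongOrbit_sum_sum] at h
    have e1 := symmetrisedNorm_add_le (μ := μ) hs1.le
      (Y := fun x => iteratedSum T v w g (T^[a] x) + E x)
      ((hS a).add ((hS a).comp (hT.iterate (a + g)).measurable))
    have e2 := symmetrisedNorm_add_le (μ := μ) hs1.le (Y := E)
      ((hS g).comp (hT.iterate a).measurable)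
    rw [symmetrisedNorm_comp (hS g) (hT.iterate a)] at e2
    have e3 := symmetrisedNorm_le (μ := μ) hs1.le hE
    have e4 := lpNorm_mono_exponent (μ := μ) hsγ hE
    rw [Real.rpow_one] at h ⊢
    rw [funext hsum]
    linarith
  rw [Real.rpow_one] at hsym
  have h1 := integral_abs_sub_integral_le_symmetrisedNorm (μ := μ) hs1.le (hS n)
  have h2 : ∫ x, |iteratedSum T v w n x| ∂μ ≤
      ∫ x, (|iteratedSum T v w n x - ∫ y, iteratedSum T v w n y ∂μ| +
        |∫ y, iteratedSum T v w n y ∂μ|) ∂μ := by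
    refine integral_mono ((hS n).abs.integrable μ)
      ((((hS n).sub (.const _)).abs.add (.const _)).integrable μ) fun x => ?_
    simpa using abs_add_le (iteratedSum T v w n x - ∫ y, iteratedSum T v w n y ∂μ)
      (∫ y, iteratedSum T v w n y ∂μ)
  rw [integral_add (((hS n).sub (.const _)).abs.integrable μ) (integrable_const _)] at h2
  have h3 := hmean v w hv hw n
  simp only [integral_const, probReal_univ, one_smul] at h2
  linarith

theorem exists_lpNorm_iteratedSum_le (hT : MeasurePreserving T μ μ) (hη : 0 < η)
    (hγ : 1 < γ) (hFCB : FunctionalCorrelationBound μ T η γ) :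
    ∃ D : ℝ, 0 < D ∧ ∀ v w : M → ℝ, IsNormalised μ η v → IsNormalised μ η w → ∀ n : ℕ,
      lpNorm (iteratedSum T v w n) (ENNReal.ofReal γ) μ ≤ D * n := by
  obtain ⟨c, hc, hmean⟩ := exists_integral_abs_iteratedSum_le hT hη hγ hFCB
  obtain ⟨C₂, hC₂, hsplit⟩ := exists_iteratedSum_two_mul_add hT hη hγ hFCB
  obtain ⟨θ, hθ0, hθ, hθ'⟩ := exists_two_lt_rpow_and_lt_two_rpow (s := γ) (κ := 1)
    (by linarith) (by linarith)
  obtain ⟨K, -, hrec⟩ := exists_bound_of_block_recursion hθ0 one_pos hθ'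
  obtain ⟨C, hC, hblock⟩ := exists_lpNorm_two_blocks_le (κ := 1) (ρ := 2) hT (by linarith) hFCB
    hγ.le (by linarith) hθ0 hθ hc K
  obtain ⟨D, hD, hbound⟩ := hrec (C + C₂) ((K : ℝ) ^ 2) (by positivity)
  refine ⟨D, hD, fun v w hv hw n => ?_⟩
  have hvm := hv.bddMeasurable hη
  have hwm := hw.bddMeasurable hη
  have hS := hvm.iteratedSum hwm hT.measurable
  have htriv : ∀ N : ℕ, lpNorm (iteratedSum T v w N) (ENNReal.ofReal γ) μ ≤ (N : ℝ) ^ 2 :=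
    fun N => lpNorm_le_of_abs_le (by linarith) (hS N) (by positivity)
      (abs_iteratedSum_le T hv.abs_le hw.abs_le N)
  rw [← Real.rpow_one (n : ℝ)]
  refine hbound (fun N => lpNorm (iteratedSum T v w N) (ENNReal.ofReal γ) μ)
    (by simpa using htriv 0) (fun N hN => (htriv N).trans ?_) (fun a g ha hK => ?_) n
  · have : (N : ℝ) ≤ K := by exact_mod_cast hN.le
    gcongr
  have hN : (a : ℝ) ≤ ((2 * a + g : ℕ) : ℝ) := by exact_mod_cast (by omega : a ≤ 2 * a + g)
  obtain ⟨E, hE, hE', hsum⟩ := hsplit v w hv hw a g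
  have h := hblock a g ha hK _
    ((isBlockFunctional_sum_sum hvm.1 hv.abs_le hv.holder hwm.1 hw.abs_le hw.holder a).mono
      (by rw [Real.rpow_two]; gcongr))
    (by
      rw [alongOrbit_sum_sum, Real.rpow_one]
      exact (hmean v w hv hw a).trans (mul_le_mul_of_nonneg_left hN hc))
  rw [alongOrbit_sum_sum] at h
  have e1 := lpNorm_add_le_of_bddMeasurable (μ := μ) hγ.le
    (g := fun x => iteratedSum T v w g (T^[a] x) + E x)
    ((hS a).add ((hS a).comp (hT.iterate (a + g)).measurable))
  have e2 := lpNorm_add_le_of_bddMeasurable (μ := μ) hγ.le (g := E)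
    ((hS g).comp (hT.iterate a).measurable)
  rw [lpNorm_comp_measurePreserving' (hS g) (hT.iterate a)] at e2
  rw [Real.rpow_one] at h ⊢
  rw [funext hsum]
  linarith

end IteratedSums

theorem isNormalised_div {M : Type*} [MetricSpace M] [MeasurableSpace M] {μ : Measure M} {η : ℝ}
    {v : M → ℝ} {A B : ℝ} (hA : 0 ≤ A) (hB : 0 ≤ B) (hAB : 0 < A + B) (hv : ∀ x, |v x| ≤ A)
    (hvh : ∀ x y, |v x - v y| ≤ B * dist x y ^ η) (hv0 : ∫ x, v x ∂μ = 0) :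
    IsNormalised μ η fun x => v x / (A + B) where
  abs_le x := by
    rw [abs_div, abs_of_pos hAB, div_le_one hAB]
    linarith [hv x]
  holder x y := by
    rw [← sub_div, abs_div, abs_of_pos hAB, div_le_iff₀ hAB]
    have : 0 ≤ dist x y ^ η := by positivity
    nlinarith [hvh x y]
  integral_eq := by rw [integral_div, hv0, zero_div]

/-- **Theorem 2.5(b).** If `T` satisfies the Functional Correlation Bound with rate `n^{-γ}`,
`γ > 1`, then there is `C > 0` such that `‖𝕊_{v,w}(n)‖_{L^{γ}(μ)} ≤ C n ‖v‖_η ‖w‖_η` for all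
`n ≥ 1` and all bounded `η`-Hölder mean-zero observables `v, w`, where
`𝕊_{v,w}(n) = ∑_{0 ≤ i < j < n} v∘T^i · w∘T^j`. -/
theorem stmt1 {M : Type*} [MetricSpace M] [MeasurableSpace M] [BorelSpace M]
    (μ : Measure M) [IsProbabilityMeasure μ] (T : M → M) (hT : MeasurePreserving T μ μ)
    (η : ℝ) (hη0 : 0 < η) (hη1 : η ≤ 1) (γ : ℝ) (hγ : 1 < γ)
    (hFCB : FunctionalCorrelationBound μ T η γ) :
    ∃ C : ℝ, 0 < C ∧
      ∀ (n : ℕ), 1 ≤ n →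
      ∀ (v w : M → ℝ) (Vinf Vh Winf Wh : ℝ),
        0 ≤ Vinf → 0 ≤ Vh → 0 ≤ Winf → 0 ≤ Wh →
        (∀ x, |v x| ≤ Vinf) → (∀ x y, |v x - v y| ≤ Vh * dist x y ^ η) →
        (∀ x, |w x| ≤ Winf) → (∀ x y, |w x - w y| ≤ Wh * dist x y ^ η) →
        (∫ x, v x ∂μ) = 0 → (∫ x, w x ∂μ) = 0 →
        eLpNorm
            (fun x => ∑ j ∈ Finset.range n, ∑ i ∈ Finset.range j,
              v (T^[i] x) * w (T^[j] x))
            (ENNReal.ofReal γ) μ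
          ≤ ENNReal.ofReal (C * (n : ℝ) * (Vinf + Vh) * (Winf + Wh)) := by
  obtain ⟨D, hD, hbound⟩ := exists_lpNorm_iteratedSum_le hT hη0 hγ hFCB
  refine ⟨D, hD, fun n _ v w Vinf Vh Winf Wh hVinf hVh hWinf hWh hv hvh hw hwh hv0 hw0 => ?_⟩
  have hzero : ∀ {u : M → ℝ} {A B : ℝ}, 0 ≤ A → 0 ≤ B → A + B = 0 → (∀ x, |u x| ≤ A) →
      ∀ x, u x = 0 := by
    intro u A B hA hB hAB hu x
    exact abs_eq_zero.1 (le_antisymm ((hu x).trans (by linarith)) (abs_nonneg _))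
  rcases (add_nonneg hVinf hVh).eq_or_lt with hV | hV
  · simp [hzero hVinf hVh hV.symm hv]
  rcases (add_nonneg hWinf hWh).eq_or_lt with hW | hW
  · simp [hzero hWinf hWh hW.symm hw]
  have hv' := isNormalised_div hVinf hVh hV hv hvh hv0
  have hw' := isNormalised_div hWinf hWh hW hw hwh hw0
  have hS := (hv'.bddMeasurable hη0).iteratedSum (hw'.bddMeasurable hη0) hT.measurable n
  have hscale : (fun x => ∑ j ∈ Finset.range n, ∑ i ∈ Finset.range j,
      v (T^[i] x) * w (T^[j] x)) = ((Vinf + Vh) * (Winf + Wh)) •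
        iteratedSum T (fun x => v x / (Vinf + Vh)) (fun x => w x / (Winf + Wh)) n := by
    funext x
    simp only [Pi.smul_apply, iteratedSum, smul_eq_mul, Finset.mul_sum]
    refine Finset.sum_congr rfl fun j _ => Finset.sum_congr rfl fun i _ => ?_
    field_simp
  rw [hscale, eLpNorm_const_smul, ← ofReal_lpNorm (hS.memLp μ _), ← ofReal_norm,
    ← ENNReal.ofReal_mul (norm_nonneg _), Real.norm_of_nonneg (by positivity)]
  refine ENNReal.ofReal_le_ofReal ?_
  calc _ ≤ (Vinf + Vh) * (Winf + Wh) * (D * n) := by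
        gcongr
        exact hbound _ _ hv' hw' n
    _ = _ := by ring
end

section
/- Let γ > 1 and suppose T satisfies the Functional Correlation Bound with rate n^{−γ} for η-Hölder observables. Then there exists a constant C > 0 with the following property: for every bounded η-Hölder v : M → ℝ with ∫_M v dμ = 0, every D > 0, every integer k ≥ 1, and every integer n ≥ 2k such that ‖S_v(m)‖_{L^{2γ}(μ)} ≤ D m^{1/2} ‖v‖_η holds for all integers 1 ≤ m < n, one has ‖S_v(n)‖_{L^{2γ}(μ)}^{2γ} ≤ C (k^{1+γ} + k^{1−γ} D^{2γ}) n^{γ} ‖v‖_η^{2γ}. -/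
open MeasureTheory Function

theorem rpow_tangent_le {r x y : ℝ} (hr : 1 ≤ r) (hx : 0 ≤ x) (hy : 0 ≤ y) :
    x ^ r + r * x ^ (r - 1) * (y - x) ≤ y ^ r := by
  rcases hx.eq_or_lt with rfl | hx
  · rcases hr.eq_or_lt with rfl | hr'
    · simp
    · rw [Real.zero_rpow (by linarith), Real.zero_rpow (by linarith)]
      simpa using Real.rpow_nonneg hy r
  · have hB := one_add_mul_self_le_rpow_one_add (s := y / x - 1)
      (by have := div_nonneg hy hx.le; linarith) hr
    rw [add_sub_cancel, Real.div_rpow hy hx.le, le_div_iff₀ (by positivity)] at hB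
    have hxr : x ^ r = x ^ (r - 1) * x := by
      rw [Real.rpow_sub_one hx.ne']; field_simp
    calc _ = (1 + r * (y / x - 1)) * x ^ r := by rw [hxr]; field_simp
      _ ≤ _ := hB

theorem abs_rpow_sub_abs_rpow_le {r a b R : ℝ} (hr : 1 ≤ r) (ha : |a| ≤ R) (hb : |b| ≤ R) :
    |(|a| ^ r - |b| ^ r)| ≤ r * R ^ (r - 1) * |a - b| := by
  have key : ∀ {a b : ℝ}, |a| ≤ R → |a| ^ r - |b| ^ r ≤ r * R ^ (r - 1) * |a - b| := by
    intro a b ha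
    have h := rpow_tangent_le hr (abs_nonneg a) (abs_nonneg b)
    have h1 : r * |a| ^ (r - 1) * (|a| - |b|) ≤ r * R ^ (r - 1) * |a - b| := by
      calc _ ≤ r * |a| ^ (r - 1) * |a - b| := by
            gcongr; exact abs_sub_abs_le_abs_sub a b
        _ ≤ _ := by
            gcongr
    linarith
  rw [abs_le]
  constructor
  · have := key (b := a) hb
    rw [abs_sub_comm] at this
    linarith
  · exact key ha

theorem rpow_sub_one_sub_mul_sub_le {s u w R : ℝ} (hs : 2 ≤ s) (hu : 0 ≤ u) (hw : 0 ≤ w)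
    (huR : u ≤ R) (hwR : w ≤ R) :
    (w ^ (s - 1) - u ^ (s - 1)) * (w - u) ≤ (s - 1) * R ^ (s - 2) * (w - u) ^ 2 := by
  wlog h : u ≤ w generalizing u w
  · have := this hw hu hwR huR (by linarith)
    linarith
  have h1 := rpow_tangent_le (r := s - 1) (by linarith) hw hu
  rw [show s - 1 - 1 = s - 2 by ring] at h1
  have h2 : w ^ (s - 2) ≤ R ^ (s - 2) := by gcongr
  have h3 : (s - 1) * w ^ (s - 2) * (w - u) ≤ (s - 1) * R ^ (s - 2) * (w - u) := by
    have : 0 ≤ w - u := by linarith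
    have : 0 ≤ s - 1 := by linarith
    gcongr
  nlinarith

theorem abs_add_rpow_le {s : ℝ} (hs : 2 < s) (a b : ℝ) :
    |a + b| ^ s ≤ |a| ^ s + s * (|a| ^ (s - 2) * a) * b +
      s * (s - 1) * 2 ^ (s - 2) * (|a| ^ (s - 2) * b ^ 2 + |b| ^ s) := by
  set c := a + b with hc
  have hb : b = c - a := by rw [hc]; ring
  have e1 : ∀ {x : ℝ}, 0 ≤ x → x ^ (s - 1) = x ^ (s - 2) * x := fun {x} hx => by
    rw [show s - 1 = s - 2 + 1 by ring, Real.rpow_add_one' hx (by linarith)]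
  have e2 : ∀ {x : ℝ}, 0 ≤ x → x ^ s = x ^ (s - 2) * x ^ 2 := fun {x} hx => by
    conv_lhs => rw [show s = s - 2 + (2 : ℕ) by push_cast; ring,
      Real.rpow_add_natCast' hx (by push_cast; linarith)]
  -- convexity: compare with the tangent at `c`
  have t1 := rpow_tangent_le (r := s) (by linarith) (abs_nonneg c) (abs_nonneg a)
  have t2 : c * a ≤ |c| * |a| := by rw [← abs_mul]; exact le_abs_self _
  have hcs : 0 ≤ |c| ^ (s - 2) := by positivity
  have has : 0 ≤ |a| ^ (s - 2) := by positivity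
  have hc2 : |c| * |c| = c * c := abs_mul_abs_self c
  have ha2 : |a| * |a| = a * a := abs_mul_abs_self a
  have t3 : |c| ^ s ≤ |a| ^ s + s * (|c| ^ (s - 2) * c) * (c - a) := by
    rw [e1 (abs_nonneg c)] at t1
    have : s * (|c| ^ (s - 2) * |c|) * (|a| - |c|) ≥ - (s * (|c| ^ (s - 2) * c) * (c - a)) := by
      have h : 0 ≤ s * |c| ^ (s - 2) * (|c| * |a| - c * a) :=
        mul_nonneg (by positivity) (by linarith)
      have : s * (|c| ^ (s - 2) * |c|) * (|a| - |c|) + s * (|c| ^ (s - 2) * c) * (c - a)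
        = s * |c| ^ (s - 2) * (|c| * |a| - c * a) := by linear_combination (- s * |c| ^ (s - 2)) * hc2
      linarith
    linarith
  set R := max |a| |c| with hR
  have hRa : |a| ≤ R := le_max_left _ _
  have hRc : |c| ≤ R := le_max_right _ _
  have hR0 : 0 ≤ R := (abs_nonneg a).trans hRa
  have q1 := rpow_sub_one_sub_mul_sub_le hs.le (abs_nonneg a) (abs_nonneg c) hRa hRc
  rw [e1 (abs_nonneg c), e1 (abs_nonneg a)] at q1
  have q2 : |c| ^ (s - 2) ≤ R ^ (s - 2) := by gcongr
  have q3 : |a| ^ (s - 2) ≤ R ^ (s - 2) := by gcongr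
  have q4 : (|c| ^ (s - 2) * c - |a| ^ (s - 2) * a) * (c - a)
      ≤ (s - 1) * R ^ (s - 2) * (c - a) ^ 2 := by
    have hRs : 0 ≤ R ^ (s - 2) := by positivity
    have h : 0 ≤ (2 * (s - 1) * R ^ (s - 2) - |c| ^ (s - 2) - |a| ^ (s - 2))
        * (|c| * |a| - c * a) := mul_nonneg (by nlinarith) (by linarith)
    linear_combination q1 + h - (|c| ^ (s - 2) - (s - 1) * R ^ (s - 2)) * hc2 -
      (|a| ^ (s - 2) - (s - 1) * R ^ (s - 2)) * ha2
  have q5 : R ^ (s - 2) ≤ 2 ^ (s - 2) * (|a| ^ (s - 2) + |b| ^ (s - 2)) := by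
    have hbs : 0 ≤ |b| ^ (s - 2) := by positivity
    have hle : R ≤ 2 * max |a| |b| := by
      have := abs_add_le a b
      have := le_max_left |a| |b|
      have := le_max_right |a| |b|
      have := abs_nonneg a
      exact max_le (by linarith) (by linarith)
    calc R ^ (s - 2) ≤ (2 * max |a| |b|) ^ (s - 2) := by gcongr
      _ = 2 ^ (s - 2) * (max |a| |b|) ^ (s - 2) := by
        rw [Real.mul_rpow (by norm_num) (by positivity)]
      _ ≤ _ := by
        gcongr
        rcases max_cases |a| |b| with h | h <;> rw [h.1] <;> linarith
  have q6 : R ^ (s - 2) * b ^ 2 ≤ 2 ^ (s - 2) * (|a| ^ (s - 2) * b ^ 2 + |b| ^ s) := by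
    rw [e2 (abs_nonneg b), sq_abs]
    calc _ ≤ 2 ^ (s - 2) * (|a| ^ (s - 2) + |b| ^ (s - 2)) * b ^ 2 := by gcongr
      _ = _ := by ring
  rw [← hb] at t3 q4
  have q7 : s * ((s - 1) * (R ^ (s - 2) * b ^ 2)) ≤
      s * ((s - 1) * (2 ^ (s - 2) * (|a| ^ (s - 2) * b ^ 2 + |b| ^ s))) := by
    have : 0 ≤ s - 1 := by linarith
    gcongr
  have q8 := mul_le_mul_of_nonneg_left q4 (by linarith : 0 ≤ s)
  linarith

theorem rpow_mul_le_add {γ x Q l : ℝ} (hγ : 1 ≤ γ) (hQ : 0 ≤ Q) (hl : 0 < l) :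
    |x| ^ (2 * γ - 2) * Q ≤ l⁻¹ * |x| ^ (2 * γ) + l⁻¹ * (Q * l) ^ γ := by
  have e : ∀ {r : ℝ}, |x| ^ (2 * r) = (x ^ 2) ^ r := fun {r} => by
    rw [Real.rpow_mul (abs_nonneg x), Real.rpow_two, sq_abs]
  rw [show 2 * γ - 2 = 2 * (γ - 1) by ring, e, e]
  have e1 : ∀ {y : ℝ}, 0 ≤ y → y ^ γ = y ^ (γ - 1) * y := fun {y} hy => by
    conv_lhs => rw [show γ = γ - 1 + 1 by ring, Real.rpow_add_one' hy (by linarith)]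
  rw [← mul_add, inv_mul_eq_div, le_div_iff₀ hl, mul_assoc]
  have hx : 0 ≤ x ^ 2 := sq_nonneg x
  have hQl : 0 ≤ Q * l := by positivity
  rcases le_total (Q * l) (x ^ 2) with h | h
  · calc _ ≤ (x ^ 2) ^ (γ - 1) * x ^ 2 := by gcongr
      _ ≤ _ := by rw [← e1 hx]; have := Real.rpow_nonneg hQl γ; linarith
  · calc _ ≤ (Q * l) ^ (γ - 1) * (Q * l) := by gcongr
      _ ≤ _ := by rw [← e1 hQl]; have := Real.rpow_nonneg hx γ; linarith

/-- The Functional Correlation Bound with an explicit constant `C₀`. -/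
def FunctionalCorrelationBoundWith {M : Type*} [MetricSpace M] [MeasurableSpace M]
    (μ : Measure M) (T : M → M) (η γ C₀ : ℝ) : Prop :=
  ∀ (q p : ℕ), p < q →
    ∀ n : ℕ → ℕ, Monotone n → n (p - 1) < n p →
    ∀ G : (Fin q → M) → ℝ, Measurable G →
    ∀ Ginf : ℝ, 0 ≤ Ginf → (∀ x, |G x| ≤ Ginf) →
    ∀ Gh : Fin q → ℝ, (∀ i, 0 ≤ Gh i) →
    (∀ (i : Fin q) (x : Fin q → M) (y : M),
        |G x - G (Function.update x i y)| ≤ Gh i * dist (x i) y ^ η) →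
    |(∫ x, G (fun i => T^[n i] x) ∂μ) -
        ∫ x₀, ∫ x₁, G (fun i => if (i : ℕ) < p then T^[n i] x₀ else T^[n i] x₁) ∂μ ∂μ|
      ≤ C₀ * ((n p : ℝ) - (n (p - 1) : ℝ)) ^ (-γ) * (Ginf + ∑ i, Gh i)

/-- `f` is measurable and bounded by `R` in absolute value. -/
structure IsBddMeasurable {Ω : Type*} [MeasurableSpace Ω] (f : Ω → ℝ) (R : ℝ) : Prop where
  measurable : Measurable f
  bound : ∀ x, |f x| ≤ R

theorem IsBddMeasurable.integrable {Ω : Type*} [MeasurableSpace Ω] {μ : Measure Ω}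
    [IsFiniteMeasure μ] {f : Ω → ℝ} {R : ℝ} (hf : IsBddMeasurable f R) : Integrable f μ :=
  Integrable.of_bound hf.measurable.aestronglyMeasurable R (Filter.Eventually.of_forall hf.bound)

theorem IsBddMeasurable.abs_rpow {Ω : Type*} [MeasurableSpace Ω] {f : Ω → ℝ} {R : ℝ}
    (hf : IsBddMeasurable f R) {r : ℝ} (hr : 0 ≤ r) :
    IsBddMeasurable (fun x => |f x| ^ r) (R ^ r) where
  measurable := (hf.measurable.abs).pow_const r
  bound x := by
    rw [abs_of_nonneg (by positivity)]
    exact Real.rpow_le_rpow (abs_nonneg _) (hf.bound x) hr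

theorem IsBddMeasurable.mul {Ω : Type*} [MeasurableSpace Ω] {f g : Ω → ℝ} {R S : ℝ}
    (hf : IsBddMeasurable f R) (hg : IsBddMeasurable g S) :
    IsBddMeasurable (fun x => f x * g x) (R * S) where
  measurable := hf.measurable.mul hg.measurable
  bound x := by
    rw [abs_mul]
    exact mul_le_mul (hf.bound x) (hg.bound x) (abs_nonneg _) ((abs_nonneg _).trans (hf.bound x))

theorem IsBddMeasurable.comp {Ω Ω' : Type*} [MeasurableSpace Ω] [MeasurableSpace Ω'] {f : Ω → ℝ}
    {R : ℝ} (hf : IsBddMeasurable f R) {g : Ω' → Ω} (hg : Measurable g) :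
    IsBddMeasurable (fun x => f (g x)) R :=
  ⟨hf.measurable.comp hg, fun x => hf.bound (g x)⟩

theorem IsBddMeasurable.sum {Ω ι : Type*} [MeasurableSpace Ω] {f : ι → Ω → ℝ} {R : ℝ}
    {s : Finset ι} (hf : ∀ i, IsBddMeasurable (f i) R) :
    IsBddMeasurable (fun x => ∑ i ∈ s, f i x) (s.card * R) where
  measurable := Finset.measurable_fun_sum s fun i _ => (hf i).measurable
  bound x := by
    refine (Finset.abs_sum_le_sum_abs _ _).trans ?_
    simpa using Finset.sum_le_sum fun i (_ : i ∈ s) => (hf i).bound x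

theorem MeasureTheory.MeasurePreserving.integral_comp_iterate {M : Type*} [MeasurableSpace M] {μ : Measure M}
    {T : M → M} (hT : MeasurePreserving T μ μ) {f : M → ℝ} (hf : Measurable f) (n : ℕ) :
    ∫ x, f (T^[n] x) ∂μ = ∫ x, f x ∂μ := by
  have h := hT.iterate n
  rw [← integral_map h.measurable.aemeasurable hf.aestronglyMeasurable, h.map_eq]

theorem eLpNorm_rpow_eq_ofReal_integral {Ω : Type*} [MeasurableSpace Ω] {μ : Measure Ω}
    [IsFiniteMeasure μ] {f : Ω → ℝ} {R s : ℝ} (hf : IsBddMeasurable f R) (hs : 0 < s) :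
    eLpNorm f (ENNReal.ofReal s) μ ^ s = ENNReal.ofReal (∫ x, |f x| ^ s ∂μ) := by
  rw [eLpNorm_eq_lintegral_rpow_enorm_toReal (by simpa using hs) ENNReal.ofReal_ne_top,
    ENNReal.toReal_ofReal hs.le, one_div, ENNReal.rpow_inv_rpow hs.ne',
    ofReal_integral_eq_lintegral_ofReal (hf.abs_rpow hs.le).integrable
      (Filter.Eventually.of_forall fun x => by positivity)]
  refine lintegral_congr fun x => ?_
  rw [Real.enorm_eq_ofReal_abs, ENNReal.ofReal_rpow_of_nonneg (abs_nonneg _) hs.le]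

/-- Decay of correlations for centred observables. -/
theorem FunctionalCorrelationBoundWith.abs_integral_mul_le {M : Type*} [MetricSpace M]
    [MeasurableSpace M] {μ : Measure M} [IsProbabilityMeasure μ] {T : M → M} {η γ C₀ : ℝ}
    (hF : FunctionalCorrelationBoundWith μ T η γ C₀)
    (hT : MeasurePreserving T μ μ)
    {v : M → ℝ} {V : ℝ} (hv : IsBddMeasurable v V)
    (hvh : ∀ x y, |v x - v y| ≤ V * dist x y ^ η) (hV : 0 ≤ V)
    (hmean : ∫ x, v x ∂μ = 0) {i m : ℕ} (him : i < m) :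
    |∫ x, v (T^[i] x) * v (T^[m] x) ∂μ| ≤ 3 * C₀ * V ^ 2 * ((m - i : ℕ) : ℝ) ^ (-γ) := by
  have h := hF 2 1 one_lt_two (fun j => if j = 0 then i else m)
    (by
      intro a b hab
      dsimp only
      split_ifs <;> omega) (by simpa using him) (fun x => v (x 0) * v (x 1))
    ((hv.measurable.comp (measurable_pi_apply 0)).mul (hv.measurable.comp (measurable_pi_apply 1)))
    (V * V) (by positivity)
    (fun x => by
      rw [abs_mul]
      exact mul_le_mul (hv.bound _) (hv.bound _) (abs_nonneg _) hV)
    (fun _ => V * V) (fun _ => by positivity)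
    (fun j x y => by
      fin_cases j
      · simp only [Fin.zero_eta, Function.update_self, Fin.isValue, ne_eq, one_ne_zero,
          not_false_eq_true, Function.update_of_ne, ← sub_mul, abs_mul]
        calc _ ≤ (V * dist (x 0) y ^ η) * V :=
              mul_le_mul (hvh _ _) (hv.bound _) (abs_nonneg _) ((abs_nonneg _).trans (hvh _ _))
          _ = _ := by ring
      · simp only [Fin.mk_one, Function.update_self, Fin.isValue, ne_eq, zero_ne_one,
          not_false_eq_true, Function.update_of_ne, ← mul_sub, abs_mul]
        calc _ ≤ V * (V * dist (x 1) y ^ η) :=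
              mul_le_mul (hv.bound _) (hvh _ _) (abs_nonneg _) hV
          _ = _ := by ring)
  have hm : ∫ x, v (T^[m] x) ∂μ = 0 := by
    rw [hT.integral_comp_iterate hv.measurable, hmean]
  simp [integral_const_mul, hm] at h
  rw [Nat.cast_sub him.le]
  refine h.trans_eq (by ring)

theorem sum_rpow_neg_le_tsum {γ : ℝ} (hγ : 1 < γ) (m : ℕ) :
    ∑ i ∈ Finset.range m, ((m - i : ℕ) : ℝ) ^ (-γ) ≤ ∑' n : ℕ, (n : ℝ) ^ (-γ) := by
  have hs : Summable fun n : ℕ => (n : ℝ) ^ (-γ) := Real.summable_nat_rpow.2 (by linarith)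
  calc _ = ∑ n ∈ Finset.range m, ((n + 1 : ℕ) : ℝ) ^ (-γ) := by
        rw [← Finset.sum_range_reflect]
        refine Finset.sum_congr rfl fun i hi => ?_
        have := Finset.mem_range.1 hi
        congr 2
        omega
    _ ≤ ∑ n ∈ Finset.range (m + 1), (n : ℝ) ^ (-γ) := by
        rw [Finset.sum_range_succ' _ m]
        have : (0 : ℝ) ≤ ((0 : ℕ) : ℝ) ^ (-γ) := by positivity
        linarith
    _ ≤ _ := hs.sum_le_tsum _ fun i _ => by positivity

theorem FunctionalCorrelationBoundWith.integral_birkhoff_sq_le {M : Type*} [MetricSpace M]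
    [MeasurableSpace M] {μ : Measure M} [IsProbabilityMeasure μ] {T : M → M} {η γ C₀ : ℝ}
    (hF : FunctionalCorrelationBoundWith μ T η γ C₀) (hC : 0 ≤ C₀) (hγ : 1 < γ)
    (hT : MeasurePreserving T μ μ)
    {v : M → ℝ} {V : ℝ} (hv : IsBddMeasurable v V)
    (hvh : ∀ x y, |v x - v y| ≤ V * dist x y ^ η) (hV : 0 ≤ V)
    (hmean : ∫ x, v x ∂μ = 0) (m : ℕ) :
    ∫ x, (∑ i ∈ Finset.range m, v (T^[i] x)) ^ 2 ∂μ ≤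
      (1 + 6 * C₀ * ∑' n : ℕ, (n : ℝ) ^ (-γ)) * m * V ^ 2 := by
  have hvi : ∀ i, IsBddMeasurable (fun x => v (T^[i] x)) V := fun i =>
    hv.comp (hT.iterate i).measurable
  induction m with
  | zero => simp
  | succ m ih =>
    have hsum : IsBddMeasurable (fun x => ∑ i ∈ Finset.range m, v (T^[i] x)) _ :=
      IsBddMeasurable.sum hvi
    have e : ∀ x, (∑ i ∈ Finset.range (m + 1), v (T^[i] x)) ^ 2 =
        (∑ i ∈ Finset.range m, v (T^[i] x)) ^ 2 +
        2 * ∑ i ∈ Finset.range m, v (T^[i] x) * v (T^[m] x) + v (T^[m] x) ^ 2 := fun x => by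
      rw [Finset.sum_range_succ, ← Finset.sum_mul]; ring
    simp_rw [e]
    have i1 : Integrable (fun x => (∑ i ∈ Finset.range m, v (T^[i] x)) ^ 2) μ := by
      simpa only [sq] using (hsum.mul hsum).integrable
    have i2 : ∀ i, Integrable (fun x => v (T^[i] x) * v (T^[m] x)) μ := fun i =>
      ((hvi i).mul (hvi m)).integrable
    have i3 : Integrable (fun x => v (T^[m] x) ^ 2) μ := by
      simpa only [sq] using i2 m
    have i4 : Integrable (fun x => 2 * ∑ i ∈ Finset.range m, v (T^[i] x) * v (T^[m] x)) μ :=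
      (integrable_finsetSum _ fun i _ => i2 i).const_mul 2
    have i5 : Integrable (fun x => (∑ i ∈ Finset.range m, v (T^[i] x)) ^ 2 +
        2 * ∑ i ∈ Finset.range m, v (T^[i] x) * v (T^[m] x)) μ := i1.add i4
    rw [integral_add i5 i3, integral_add i1 i4, integral_const_mul,
      integral_finsetSum _ fun i _ => i2 i]
    have b1 : ∑ i ∈ Finset.range m, ∫ x, v (T^[i] x) * v (T^[m] x) ∂μ ≤
        3 * C₀ * V ^ 2 * ∑' n : ℕ, (n : ℝ) ^ (-γ) := by
      calc _ ≤ ∑ i ∈ Finset.range m, 3 * C₀ * V ^ 2 * ((m - i : ℕ) : ℝ) ^ (-γ) :=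
            Finset.sum_le_sum fun i hi => (le_abs_self _).trans
              (hF.abs_integral_mul_le hT hv hvh hV hmean (Finset.mem_range.1 hi))
        _ ≤ _ := by
            rw [← Finset.mul_sum]
            gcongr
            exact sum_rpow_neg_le_tsum hγ m
    have b2 : ∫ x, v (T^[m] x) ^ 2 ∂μ ≤ V ^ 2 := by
      calc _ ≤ ∫ _, V ^ 2 ∂μ := integral_mono i3 (integrable_const _) fun x =>
            sq_le_sq' (abs_le.1 ((hvi m).bound x)).1 (abs_le.1 ((hvi m).bound x)).2
        _ = V ^ 2 := by simp
    push_cast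
    linarith

/-- Decoupling of moments of a sum of observables along times separated by a gap. -/
theorem FunctionalCorrelationBoundWith.integral_abs_sum_rpow_le {M : Type*} [MetricSpace M]
    [MeasurableSpace M] {μ : Measure M} [IsProbabilityMeasure μ] {T : M → M} {η γ C₀ : ℝ}
    (hF : FunctionalCorrelationBoundWith μ T η γ C₀) (hC : 0 ≤ C₀) (hγ : 0 ≤ γ)
    {v : M → ℝ} {V : ℝ} (hv : IsBddMeasurable v V)
    (hvh : ∀ x y, |v x - v y| ≤ V * dist x y ^ η) (hV : 0 ≤ V)
    {s : ℝ} (hs : 1 ≤ s) {t : ℕ → ℕ} (ht : Monotone t) {p r g : ℕ} (hr : 0 < r) (hg : 0 < g)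
    (hgap : p = 0 ∨ t (p - 1) + g ≤ t p) :
    ∫ x, |∑ i ∈ Finset.range (p + r), v (T^[t i] x)| ^ s ∂μ ≤
      (∫ x₀, ∫ x₁, |(∑ i ∈ Finset.range p, v (T^[t i] x₀)) +
        ∑ i ∈ Finset.range r, v (T^[t (p + i)] x₁)| ^ s ∂μ ∂μ) +
      C₀ * (g : ℝ) ^ (-γ) * ((1 + s) * (((p + r : ℕ) : ℝ) * V) ^ s) := by
  rcases hgap with rfl | hgap
  · have : 0 ≤ C₀ * (g : ℝ) ^ (-γ) * ((1 + s) * (((0 + r : ℕ) : ℝ) * V) ^ s) := by positivity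
    simpa using this
  set q := p + r with hq
  have hbd : ∀ x : Fin q → M, |∑ i, v (x i)| ≤ q * V := fun x => by
    refine (Finset.abs_sum_le_sum_abs _ _).trans ?_
    simpa using Finset.sum_le_sum fun i (_ : i ∈ Finset.univ) => hv.bound (x i)
  have hqV : 0 ≤ (q : ℝ) * V := by positivity
  have h := hF q p (by omega) t ht (by omega) (fun x => |∑ i, v (x i)| ^ s)
    ((Finset.measurable_fun_sum _ fun i _ =>
      hv.measurable.comp (measurable_pi_apply i)).abs.pow_const s)
    ((q * V) ^ s) (by positivity)
    (fun x => by
      rw [abs_of_nonneg (by positivity)]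
      exact Real.rpow_le_rpow (abs_nonneg _) (hbd x) (by linarith))
    (fun _ => s * (q * V) ^ (s - 1) * V) (fun _ => by positivity)
    (fun i x y => by
      refine (abs_rpow_sub_abs_rpow_le hs (hbd _) (hbd _)).trans ?_
      rw [mul_assoc _ V]
      refine mul_le_mul_of_nonneg_left ?_ (by positivity)
      refine le_trans (le_of_eq ?_) (hvh (x i) y)
      rw [← Finset.sum_sub_distrib, Finset.sum_eq_single i]
      · simp
      · intro j _ hj
        simp [Function.update_of_ne hj]
      · simp)
  have e1 : ∀ x, ∑ i : Fin q, v (T^[t i] x) = ∑ i ∈ Finset.range q, v (T^[t i] x) := fun x =>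
    Fin.sum_univ_eq_sum_range (fun i => v (T^[t i] x)) q
  have e2 : ∀ x₀ x₁, ∑ i : Fin q, v (if (i : ℕ) < p then T^[t i] x₀ else T^[t i] x₁) =
      (∑ i ∈ Finset.range p, v (T^[t i] x₀)) + ∑ i ∈ Finset.range r, v (T^[t (p + i)] x₁) := by
    intro x₀ x₁
    rw [Fin.sum_univ_eq_sum_range (fun i => v (if i < p then T^[t i] x₀ else T^[t i] x₁)) q,
      hq, Finset.sum_range_add]
    congr 1
    · exact Finset.sum_congr rfl fun i hi => by rw [if_pos (Finset.mem_range.1 hi)]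
    · exact Finset.sum_congr rfl fun i hi => by rw [if_neg (by omega)]
  simp only [e1, e2] at h
  have h' := (le_abs_self _).trans h
  have hgr : (g : ℝ) ≤ (t p : ℝ) - t (p - 1) := by
    have : ((t (p - 1) + g : ℕ) : ℝ) ≤ (t p : ℕ) := by exact_mod_cast hgap
    push_cast at this
    linarith
  have hpow : ((t p : ℝ) - t (p - 1)) ^ (-γ) ≤ (g : ℝ) ^ (-γ) :=
    Real.rpow_le_rpow_of_nonpos (by exact_mod_cast hg) hgr (by linarith)
  have htot : (q * V) ^ s + ∑ _i : Fin q, s * (q * V) ^ (s - 1) * V = (1 + s) * (q * V) ^ s := by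
    have : (q * V) ^ s = (q * V) ^ (s - 1) * (q * V) := by
      conv_lhs => rw [show s = s - 1 + 1 by ring, Real.rpow_add_one' hqV (by linarith)]
    simp only [Finset.sum_const, Finset.card_univ, Fintype.card_fin, nsmul_eq_mul]
    linear_combination (-s) * this
  rw [htot] at h'
  have : C₀ * ((t p : ℝ) - t (p - 1)) ^ (-γ) * ((1 + s) * (q * V) ^ s) ≤
      C₀ * (g : ℝ) ^ (-γ) * ((1 + s) * (q * V) ^ s) := by
    gcongr
  linarith

/-- Rosenthal-type step for the sum of two independent variables, the second one centred. -/
theorem integral_integral_abs_add_rpow_le {Ω Ω' : Type*} [MeasurableSpace Ω] [MeasurableSpace Ω']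
    {μ : Measure Ω} [IsProbabilityMeasure μ] {ν : Measure Ω'} [IsProbabilityMeasure ν]
    {f : Ω → ℝ} {g : Ω' → ℝ} {R R' γ Q l : ℝ} (hf : IsBddMeasurable f R)
    (hg : IsBddMeasurable g R') (hγ : 1 < γ) (hmean : ∫ y, g y ∂ν = 0)
    (hQ : ∫ y, g y ^ 2 ∂ν ≤ Q) (hl : 0 < l) :
    ∫ x, ∫ y, |f x + g y| ^ (2 * γ) ∂ν ∂μ ≤
      (1 + 2 * γ * (2 * γ - 1) * 2 ^ (2 * γ - 2) / l) * ∫ x, |f x| ^ (2 * γ) ∂μ +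
      2 * γ * (2 * γ - 1) * 2 ^ (2 * γ - 2) * ((Q * l) ^ γ + l * ∫ y, |g y| ^ (2 * γ) ∂ν) / l := by
  set s := 2 * γ with hs
  set K := s * (s - 1) * 2 ^ (s - 2) with hK
  have hs2 : 2 < s := by linarith
  have hK0 : 0 ≤ K := by
    have : 0 ≤ s - 1 := by linarith
    positivity
  have hQ0 : 0 ≤ Q := (integral_nonneg fun y => sq_nonneg _).trans hQ
  set B := ∫ y, |g y| ^ s ∂ν with hB
  have i1 : Integrable g ν := hg.integrable
  have i2 : Integrable (fun y => g y ^ 2) ν := by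
    simpa only [sq] using (hg.mul hg).integrable
  have i3 : Integrable (fun y => |g y| ^ s) ν := (hg.abs_rpow (by linarith)).integrable
  have inner : ∀ a : ℝ, ∫ y, |a + g y| ^ s ∂ν ≤
      (1 + K / l) * |a| ^ s + K * ((Q * l) ^ γ + l * B) / l := by
    intro a
    have j1 : Integrable (fun y => |a| ^ s + s * (|a| ^ (s - 2) * a) * g y) ν :=
      (integrable_const _).add (i1.const_mul _)
    have j2 : Integrable (fun y => K * (|a| ^ (s - 2) * g y ^ 2 + |g y| ^ s)) ν :=
      ((i2.const_mul _).add i3).const_mul _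
    have h1 : ∫ y, |a + g y| ^ s ∂ν ≤ ∫ y, (|a| ^ s + s * (|a| ^ (s - 2) * a) * g y +
        K * (|a| ^ (s - 2) * g y ^ 2 + |g y| ^ s)) ∂ν :=
      integral_mono_of_nonneg (Filter.Eventually.of_forall fun y => by positivity) (j1.add j2)
        (Filter.Eventually.of_forall fun y => abs_add_rpow_le hs2 a (g y))
    rw [integral_add j1 j2, integral_add (integrable_const _) (i1.const_mul _),
      integral_const_mul, integral_const_mul, integral_add (i2.const_mul _) i3,
      integral_const_mul, hmean, integral_const, probReal_univ, one_smul] at h1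
    have h2 : |a| ^ (s - 2) * ∫ y, g y ^ 2 ∂ν ≤ |a| ^ (s - 2) * Q := by gcongr
    have h3 := rpow_mul_le_add (x := a) hγ.le hQ0 hl
    have h4 := mul_le_mul_of_nonneg_left (h2.trans h3) hK0
    have h5 : (1 + K / l) * |a| ^ s + K * ((Q * l) ^ γ + l * B) / l =
        |a| ^ s + K * (l⁻¹ * |a| ^ s + l⁻¹ * (Q * l) ^ γ) + K * B := by
      field_simp
      ring
    rw [h5]
    linarith
  have i4 : Integrable (fun x => |f x| ^ s) μ := (hf.abs_rpow (by linarith)).integrable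
  calc _ ≤ ∫ x, ((1 + K / l) * |f x| ^ s + K * ((Q * l) ^ γ + l * B) / l) ∂μ :=
        integral_mono_of_nonneg
          (Filter.Eventually.of_forall fun x => integral_nonneg fun y => by positivity)
          ((i4.const_mul _).add (integrable_const _))
          (Filter.Eventually.of_forall fun x => inner (f x))
    _ = _ := by
        rw [integral_add (i4.const_mul _) (integrable_const _), integral_const_mul,
          integral_const, probReal_univ, one_smul]

theorem le_exp_mul_of_le_succ {a : ℕ → ℝ} {K N : ℝ} {k : ℕ} (hK : 0 ≤ K) (hN : 0 ≤ N)
    (hk : 0 < k) (h0 : a 0 ≤ 0) (h : ∀ j < k, a (j + 1) ≤ (1 + K / k) * a j + N / k) :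
    a k ≤ Real.exp K * N := by
  have hk' : (0 : ℝ) < k := by exact_mod_cast hk
  have key : ∀ j ≤ k, a j ≤ j * (N / k) * (1 + K / k) ^ j := by
    intro j hj
    induction j with
    | zero => simpa using h0
    | succ j ih =>
      have h1 : (1 : ℝ) ≤ (1 + K / k) ^ (j + 1) :=
        one_le_pow₀ (by have : 0 ≤ K / k := by positivity
                        linarith)
      have h2 : N / k ≤ N / k * (1 + K / k) ^ (j + 1) :=
        le_mul_of_one_le_right (by positivity) h1
      have h3 : (1 + K / k) * a j ≤ (1 + K / k) * (j * (N / k) * (1 + K / k) ^ j) := by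
        have := ih (by omega)
        gcongr
      calc a (j + 1) ≤ (1 + K / k) * a j + N / k := h j (by omega)
        _ ≤ (1 + K / k) * (j * (N / k) * (1 + K / k) ^ j) + N / k * (1 + K / k) ^ (j + 1) :=
            add_le_add h3 h2
        _ = _ := by push_cast; ring
  have h1 : (1 + K / k) ^ k ≤ Real.exp K := by
    calc (1 + K / k) ^ k ≤ Real.exp (K / k) ^ k := by
          gcongr
          linarith [Real.add_one_le_exp (K / k)]
      _ = Real.exp K := by rw [← Real.exp_nat_mul]; congr 1; field_simp
  calc a k ≤ k * (N / k) * (1 + K / k) ^ k := key k le_rfl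
    _ = (1 + K / k) ^ k * N := by field_simp
    _ ≤ _ := by gcongr

/-- The increasing enumeration of the integers lying in every other block of length `l`,
starting with `[0, l)`. -/
def alternateBlocks (l i : ℕ) : ℕ := i + l * (i / l)

theorem alternateBlocks_mono (l : ℕ) : Monotone (alternateBlocks l) := fun _ _ h =>
  add_le_add h (Nat.mul_le_mul_left l (Nat.div_le_div_right h))

theorem alternateBlocks_mul_add {l b : ℕ} (j : ℕ) (hb : b < l) :
    alternateBlocks l (j * l + b) = b + 2 * l * j := by
  have : (j * l + b) / l = j := by
    rw [mul_comm, Nat.mul_add_div (by omega), Nat.div_eq_of_lt hb, add_zero]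
  rw [alternateBlocks, this]
  ring

theorem alternateBlocks_gap {l j : ℕ} (hl : 0 < l) (hj : 0 < j) :
    alternateBlocks l (j * l - 1) + (l + 1) ≤ alternateBlocks l (j * l) := by
  have h := alternateBlocks_mul_add j hl
  rw [add_zero, zero_add] at h
  have hjl : 0 < j * l := Nat.mul_pos hj hl
  have h1 : (j * l - 1) / l < j := Nat.div_lt_of_lt_mul (by rw [mul_comm l]; omega)
  have h2 : l * ((j * l - 1) / l + 1) ≤ l * j := Nat.mul_le_mul_left l h1
  have h3 : 2 * l * j = j * l + l * j := by ring
  rw [h, alternateBlocks, h3]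
  rw [mul_add] at h2
  omega

theorem sum_range_eq_sum_alternateBlocks (f : ℕ → ℝ) (l k : ℕ) :
    ∑ i ∈ Finset.range (2 * l * k), f i =
      ∑ i ∈ Finset.range (k * l), f (alternateBlocks l i) +
        ∑ i ∈ Finset.range (k * l), f (alternateBlocks l i + l) := by
  induction k with
  | zero => simp
  | succ k ih =>
    rw [show 2 * l * (k + 1) = 2 * l * k + l + l by ring, add_one_mul, Finset.sum_range_add,
      Finset.sum_range_add, ih, Finset.sum_range_add, Finset.sum_range_add]
    have e : ∀ c, ∑ b ∈ Finset.range l, f (alternateBlocks l (k * l + b) + c) =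
        ∑ b ∈ Finset.range l, f (2 * l * k + c + b) := fun c =>
      Finset.sum_congr rfl fun b hb => by
        rw [alternateBlocks_mul_add k (Finset.mem_range.1 hb), add_comm b, add_right_comm]
    have e0 := e 0
    simp only [add_zero] at e0
    rw [e0, e l]
    ring

theorem FunctionalCorrelationBoundWith.integral_alternateBlocks_le {M : Type*} [MetricSpace M]
    [MeasurableSpace M] {μ : Measure M} [IsProbabilityMeasure μ] {T : M → M} {η γ C₀ : ℝ}
    (hF : FunctionalCorrelationBoundWith μ T η γ C₀) (hC : 0 ≤ C₀) (hγ : 1 < γ)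
    (hT : MeasurePreserving T μ μ)
    {v : M → ℝ} {V : ℝ} (hv : IsBddMeasurable v V)
    (hvh : ∀ x y, |v x - v y| ≤ V * dist x y ^ η) (hV : 0 ≤ V)
    (hmean : ∫ x, v x ∂μ = 0) {k l : ℕ} (hk : 0 < k) (hl : 0 < l) :
    ∫ x, |∑ i ∈ Finset.range (k * l), v (T^[alternateBlocks l i] x)| ^ (2 * γ) ∂μ ≤
      Real.exp (2 * γ * (2 * γ - 1) * 2 ^ (2 * γ - 2)) *
        (2 * γ * (2 * γ - 1) * 2 ^ (2 * γ - 2) *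
          (((1 + 6 * C₀ * ∑' n : ℕ, (n : ℝ) ^ (-γ)) * l * V ^ 2 * k) ^ γ +
            k * ∫ x, |∑ i ∈ Finset.range l, v (T^[i] x)| ^ (2 * γ) ∂μ) +
          k * (C₀ * ((l + 1 : ℕ) : ℝ) ^ (-γ) *
            ((1 + 2 * γ) * (((k * l : ℕ) : ℝ) * V) ^ (2 * γ)))) := by
  set K := 2 * γ * (2 * γ - 1) * 2 ^ (2 * γ - 2) with hK
  have hK0 : 0 ≤ K := by
    have : 0 ≤ 2 * γ - 1 := by linarith
    positivity
  set Q := (1 + 6 * C₀ * ∑' n : ℕ, (n : ℝ) ^ (-γ)) * l * V ^ 2 with hQ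
  have hQ0 : 0 ≤ Q := by
    have : 0 ≤ ∑' n : ℕ, (n : ℝ) ^ (-γ) := tsum_nonneg fun n => by positivity
    positivity
  set B := ∫ x, |∑ i ∈ Finset.range l, v (T^[i] x)| ^ (2 * γ) ∂μ with hB
  have hB0 : 0 ≤ B := integral_nonneg fun x => by positivity
  set E := C₀ * ((l + 1 : ℕ) : ℝ) ^ (-γ) * ((1 + 2 * γ) * (((k * l : ℕ) : ℝ) * V) ^ (2 * γ))
    with hE
  have hE0 : 0 ≤ E := by positivity
  have hk' : (0 : ℝ) < k := by exact_mod_cast hk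
  have hvi : ∀ i, IsBddMeasurable (fun x => v (T^[i] x)) V := fun i =>
    hv.comp (hT.iterate i).measurable
  refine le_exp_mul_of_le_succ
    (a := fun j => ∫ x, |∑ i ∈ Finset.range (j * l), v (T^[alternateBlocks l i] x)| ^ (2 * γ) ∂μ)
    hK0 (by positivity) hk (by simp [Real.zero_rpow (by linarith : 2 * γ ≠ 0)]) fun j hj => ?_
  have hsum : IsBddMeasurable (fun x => ∑ i ∈ Finset.range l, v (T^[i] x)) _ :=
    IsBddMeasurable.sum hvi
  have hdec := hF.integral_abs_sum_rpow_le hC (by linarith) hv hvh hV (s := 2 * γ) (by linarith)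
    (alternateBlocks_mono l) (p := j * l) hl (Nat.succ_pos l)
    (by
      rcases Nat.eq_zero_or_pos j with rfl | hj0
      · left; simp
      · right; exact alternateBlocks_gap hl hj0)
  have hblock : ∀ x, ∑ i ∈ Finset.range l, v (T^[alternateBlocks l (j * l + i)] x) =
      ∑ i ∈ Finset.range l, v (T^[i] (T^[2 * l * j] x)) := fun x =>
    Finset.sum_congr rfl fun i hi => by
      rw [alternateBlocks_mul_add j (Finset.mem_range.1 hi), iterate_add_apply]
  simp only [hblock] at hdec
  have hshift : ∀ {h : M → ℝ}, Measurable h → ∫ x, h (T^[2 * l * j] x) ∂μ = ∫ x, h x ∂μ :=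
    fun hh => hT.integral_comp_iterate hh _
  have hm : ∫ x, ∑ i ∈ Finset.range l, v (T^[i] (T^[2 * l * j] x)) ∂μ = 0 := by
    rw [hshift hsum.measurable, integral_finsetSum _ fun i _ => (hvi i).integrable]
    exact Finset.sum_eq_zero fun i _ => by
      rw [hT.integral_comp_iterate hv.measurable, hmean]
  have hstep := integral_integral_abs_add_rpow_le (μ := μ) (ν := μ)
    (f := fun x => ∑ i ∈ Finset.range (j * l), v (T^[alternateBlocks l i] x))
    (IsBddMeasurable.sum fun i => hvi (alternateBlocks l i))
    (hsum.comp (hT.iterate (2 * l * j)).measurable) hγ hm (Q := Q)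
    (by
      rw [hshift (hsum.measurable.pow_const 2)]
      exact hF.integral_birkhoff_sq_le hC hγ hT hv hvh hV hmean l) hk'
  rw [hshift (hsum.abs_rpow (by linarith : 0 ≤ 2 * γ)).measurable] at hstep
  have herr : C₀ * ((l + 1 : ℕ) : ℝ) ^ (-γ) *
      ((1 + 2 * γ) * (((j * l + l : ℕ) : ℝ) * V) ^ (2 * γ)) ≤ E := by
    have : ((j * l + l : ℕ) : ℝ) ≤ ((k * l : ℕ) : ℝ) := by
      rw [← add_one_mul]
      exact_mod_cast Nat.mul_le_mul_right l hj
    rw [hE]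
    gcongr
  have hfin : (K * ((Q * k) ^ γ + k * B) + k * E) / k =
      K * ((Q * k) ^ γ + k * B) / k + E := by
    field_simp
  rw [hfin, add_one_mul]
  linarith

theorem abs_add_add_rpow_le {s : ℝ} (hs : 0 ≤ s) (a b c : ℝ) :
    |a + b + c| ^ s ≤ 3 ^ s * (|a| ^ s + |b| ^ s + |c| ^ s) := by
  have ha : 0 ≤ |a| ^ s := by positivity
  have hb : 0 ≤ |b| ^ s := by positivity
  have hc : 0 ≤ |c| ^ s := by positivity
  set m := max |a| (max |b| |c|) with hm
  have hma : |a| ≤ m := le_max_left _ _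
  have hmb : |b| ≤ m := (le_max_left _ _).trans (le_max_right _ _)
  have hmc : |c| ≤ m := (le_max_right _ _).trans (le_max_right _ _)
  have hm0 : 0 ≤ m := (abs_nonneg a).trans hma
  have h1 : |a + b + c| ≤ 3 * m := by linarith [abs_add_three a b c]
  calc |a + b + c| ^ s ≤ (3 * m) ^ s := by gcongr
    _ = 3 ^ s * m ^ s := Real.mul_rpow (by norm_num) hm0
    _ ≤ _ := by
      gcongr
      rcases max_choice |a| (max |b| |c|) with h | h
      · rw [hm, h]; linarith
      · rcases max_choice |b| |c| with h' | h' <;> rw [hm, h, h'] <;> linarith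

theorem continuous_of_abs_sub_le_dist_rpow {M : Type*} [PseudoMetricSpace M] {v : M → ℝ}
    {V η : ℝ} (hη : 0 < η) (h : ∀ x y, |v x - v y| ≤ V * dist x y ^ η) : Continuous v := by
  refine continuous_iff_continuousAt.2 fun x => tendsto_iff_dist_tendsto_zero.2 ?_
  have hc : Continuous fun y => V * dist y x ^ η :=
    continuous_const.mul ((continuous_id.dist continuous_const).rpow_const fun _ => Or.inr hη.le)
  have h0 := hc.tendsto x
  simp only [dist_self, Real.zero_rpow hη.ne', mul_zero] at h0
  exact squeeze_zero (fun _ => dist_nonneg) (fun y => h y x) h0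

/-- Moment bound for the sum over every other block, in terms of the total length `n`. -/
theorem FunctionalCorrelationBoundWith.exists_integral_alternateBlocks_le {M : Type*}
    [MetricSpace M] [MeasurableSpace M] {μ : Measure M} [IsProbabilityMeasure μ] {T : M → M}
    {η γ C₀ : ℝ} (hF : FunctionalCorrelationBoundWith μ T η γ C₀) (hC : 0 ≤ C₀) (hγ : 1 < γ)
    (hT : MeasurePreserving T μ μ) :
    ∃ C : ℝ, 0 ≤ C ∧ ∀ (v : M → ℝ) (V : ℝ), IsBddMeasurable v V →
      (∀ x y, |v x - v y| ≤ V * dist x y ^ η) → 0 ≤ V → ∫ x, v x ∂μ = 0 →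
      ∀ (D : ℝ) (k l n : ℕ), 0 ≤ D → 0 < k → 0 < l → l * k ≤ n → n ≤ 2 * k * (l + 1) →
      ∫ x, |∑ i ∈ Finset.range l, v (T^[i] x)| ^ (2 * γ) ∂μ ≤
        (D * (l : ℝ) ^ ((1 : ℝ) / 2) * V) ^ (2 * γ) →
      ∫ x, |∑ i ∈ Finset.range (k * l), v (T^[alternateBlocks l i] x)| ^ (2 * γ) ∂μ ≤
        C * (((k : ℝ) ^ (1 + γ) + (k : ℝ) ^ (1 - γ) * D ^ (2 * γ)) * (n : ℝ) ^ γ *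
          V ^ (2 * γ)) := by
  set K := 2 * γ * (2 * γ - 1) * 2 ^ (2 * γ - 2) with hK
  have hK0 : 0 ≤ K := by
    have : 0 ≤ 2 * γ - 1 := by linarith
    positivity
  set Z := 1 + 6 * C₀ * ∑' n : ℕ, (n : ℝ) ^ (-γ) with hZ
  have hZ0 : 0 ≤ Z := by
    have : 0 ≤ ∑' n : ℕ, (n : ℝ) ^ (-γ) := tsum_nonneg fun n => by positivity
    positivity
  refine ⟨Real.exp K * (K * (Z ^ γ + 1) + C₀ * 2 ^ γ * (1 + 2 * γ)), by positivity, ?_⟩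
  intro v V hv hvh hV hmean D k l n hD hk hl hlk hn hB
  have hmain := hF.integral_alternateBlocks_le hC hγ hT hv hvh hV hmean hk hl
  set B := ∫ x, |∑ i ∈ Finset.range l, v (T^[i] x)| ^ (2 * γ) ∂μ
  have hk1 : (1 : ℝ) ≤ k := by exact_mod_cast hk
  have hk0 : (0 : ℝ) < k := by linarith
  have hl0 : (0 : ℝ) < l := by exact_mod_cast hl
  have hlk' : (l : ℝ) * k ≤ n := by exact_mod_cast hlk
  have hn0 : (0 : ℝ) < n := (mul_pos hl0 hk0).trans_le hlk'
  have hn' : (n : ℝ) ≤ 2 * k * (l + 1) := by exact_mod_cast hn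
  have hkγ : 1 ≤ (k : ℝ) ^ (1 + γ) := Real.one_le_rpow hk1 (by linarith)
  have hkD : 0 ≤ (k : ℝ) ^ (1 - γ) * D ^ (2 * γ) := by positivity
  set W := ((k : ℝ) ^ (1 + γ) + (k : ℝ) ^ (1 - γ) * D ^ (2 * γ)) * (n : ℝ) ^ γ * V ^ (2 * γ)
    with hW
  have hnV : 0 ≤ (n : ℝ) ^ γ * V ^ (2 * γ) := by positivity
  have hkW : (k : ℝ) ^ (1 + γ) * ((n : ℝ) ^ γ * V ^ (2 * γ)) ≤ W := by
    rw [hW, mul_assoc _ ((n : ℝ) ^ γ)]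
    gcongr
    linarith
  have hDW : (k : ℝ) ^ (1 - γ) * D ^ (2 * γ) * ((n : ℝ) ^ γ * V ^ (2 * γ)) ≤ W := by
    rw [hW, mul_assoc _ ((n : ℝ) ^ γ)]
    gcongr
    linarith
  have hV2 : (V ^ 2) ^ γ = V ^ (2 * γ) := by rw [Real.rpow_mul hV, Real.rpow_two]
  have b1 : (Z * l * V ^ 2 * k) ^ γ ≤ Z ^ γ * W := by
    calc (Z * l * V ^ 2 * k) ^ γ = (Z * ((l * k) * V ^ 2)) ^ γ := by ring_nf
      _ ≤ (Z * (n * V ^ 2)) ^ γ := by gcongr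
      _ = Z ^ γ * (1 * ((n : ℝ) ^ γ * V ^ (2 * γ))) := by
        rw [Real.mul_rpow hZ0 (by positivity), Real.mul_rpow hn0.le (by positivity), hV2, one_mul]
      _ ≤ Z ^ γ * W := by
        gcongr
        exact (mul_le_mul_of_nonneg_right hkγ hnV).trans hkW
  have b2 : k * B ≤ W := by
    have e1 : (D * (l : ℝ) ^ ((1 : ℝ) / 2) * V) ^ (2 * γ) =
        D ^ (2 * γ) * (l : ℝ) ^ γ * V ^ (2 * γ) := by
      rw [Real.mul_rpow (by positivity) hV, Real.mul_rpow hD (by positivity),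
        ← Real.rpow_mul hl0.le]
      congr 3
      ring
    have e2 : (k : ℝ) * (l : ℝ) ^ γ ≤ (k : ℝ) ^ (1 - γ) * (n : ℝ) ^ γ := by
      calc (k : ℝ) * (l : ℝ) ^ γ ≤ k * (n / k : ℝ) ^ γ := by
            gcongr
            rwa [le_div_iff₀ hk0]
        _ = _ := by
            rw [Real.div_rpow hn0.le hk0.le, Real.rpow_sub hk0, Real.rpow_one]
            ring
    calc k * B ≤ k * (D ^ (2 * γ) * (l : ℝ) ^ γ * V ^ (2 * γ)) := by
          rw [← e1]; gcongr
      _ = (k * (l : ℝ) ^ γ) * (D ^ (2 * γ) * V ^ (2 * γ)) := by ring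
      _ ≤ ((k : ℝ) ^ (1 - γ) * (n : ℝ) ^ γ) * (D ^ (2 * γ) * V ^ (2 * γ)) := by gcongr
      _ = (k : ℝ) ^ (1 - γ) * D ^ (2 * γ) * ((n : ℝ) ^ γ * V ^ (2 * γ)) := by ring
      _ ≤ W := hDW
  have b3 : k * (C₀ * ((l + 1 : ℕ) : ℝ) ^ (-γ) *
      ((1 + 2 * γ) * (((k * l : ℕ) : ℝ) * V) ^ (2 * γ))) ≤ C₀ * 2 ^ γ * (1 + 2 * γ) * W := by
    have e1 : ((l + 1 : ℕ) : ℝ) ^ (-γ) ≤ 2 ^ γ * (k : ℝ) ^ γ * ((n : ℝ) ^ γ)⁻¹ := by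
      calc ((l + 1 : ℕ) : ℝ) ^ (-γ) ≤ (n / (2 * k) : ℝ) ^ (-γ) := by
            refine Real.rpow_le_rpow_of_nonpos (by positivity) ?_ (by linarith)
            rw [div_le_iff₀ (by positivity)]
            push_cast
            linarith
        _ = _ := by
            rw [Real.rpow_neg (by positivity), Real.div_rpow hn0.le (by positivity), inv_div,
              Real.mul_rpow (by norm_num) hk0.le, div_eq_mul_inv]
    have e2 : (((k * l : ℕ) : ℝ) * V) ^ (2 * γ) ≤
        (n : ℝ) ^ γ * (n : ℝ) ^ γ * V ^ (2 * γ) := by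
      rw [← Real.rpow_add hn0, ← two_mul, ← Real.mul_rpow hn0.le hV]
      have : ((k * l : ℕ) : ℝ) ≤ n := by exact_mod_cast (mul_comm k l).trans_le hlk
      gcongr
    calc _ ≤ k * (C₀ * (2 ^ γ * (k : ℝ) ^ γ * ((n : ℝ) ^ γ)⁻¹) *
          ((1 + 2 * γ) * ((n : ℝ) ^ γ * (n : ℝ) ^ γ * V ^ (2 * γ)))) := by gcongr
      _ = C₀ * 2 ^ γ * (1 + 2 * γ) * ((k : ℝ) ^ (1 + γ) * ((n : ℝ) ^ γ * V ^ (2 * γ))) := by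
        rw [Real.rpow_add hk0, Real.rpow_one]
        field_simp
      _ ≤ _ := by gcongr
  refine hmain.trans ?_
  rw [mul_assoc (Real.exp K)]
  refine mul_le_mul_of_nonneg_left ?_ (Real.exp_pos K).le
  have := mul_le_mul_of_nonneg_left (add_le_add b1 b2) hK0
  linarith

/-- **Claim in the proof of Theorem 2.5(a).** There is `C > 0` such that for every bounded
`η`-Hölder mean-zero `v`, every `D > 0`, every `k ≥ 1` and every `n ≥ 2k` such that the
inductive bound `‖S_v(m)‖_{L^{2γ}} ≤ D m^{1/2} ‖v‖_η` holds for all `1 ≤ m < n`, one has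
`‖S_v(n)‖_{L^{2γ}}^{2γ} ≤ C (k^{1+γ} + k^{1-γ} D^{2γ}) n^γ ‖v‖_η^{2γ}`. -/
theorem stmt11 {M : Type*} [MetricSpace M] [MeasurableSpace M] [BorelSpace M]
    (μ : Measure M) [IsProbabilityMeasure μ] (T : M → M) (hT : MeasurePreserving T μ μ)
    (η : ℝ) (hη0 : 0 < η) (hη1 : η ≤ 1) (γ : ℝ) (hγ : 1 < γ)
    (hFCB : FunctionalCorrelationBound μ T η γ) :
    ∃ C : ℝ, 0 < C ∧
      ∀ (v : M → ℝ) (Vinf Vh : ℝ), 0 ≤ Vinf → 0 ≤ Vh →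
        (∀ x, |v x| ≤ Vinf) →
        (∀ x y, |v x - v y| ≤ Vh * dist x y ^ η) →
        (∫ x, v x ∂μ) = 0 →
      ∀ (D : ℝ), 0 < D → ∀ (k : ℕ), 1 ≤ k → ∀ (n : ℕ), 2 * k ≤ n →
        (∀ m : ℕ, 1 ≤ m → m < n →
          eLpNorm (fun x => ∑ i ∈ Finset.range m, v (T^[i] x)) (ENNReal.ofReal (2 * γ)) μ
            ≤ ENNReal.ofReal (D * (m : ℝ) ^ ((1 : ℝ) / 2) * (Vinf + Vh))) →
        eLpNorm (fun x => ∑ i ∈ Finset.range n, v (T^[i] x)) (ENNReal.ofReal (2 * γ)) μ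
            ^ (2 * γ)
          ≤ ENNReal.ofReal (C * ((k : ℝ) ^ (1 + γ) + (k : ℝ) ^ (1 - γ) * D ^ (2 * γ)) *
              (n : ℝ) ^ γ * (Vinf + Vh) ^ (2 * γ)) := by
  obtain ⟨C₀, hC₀, hF⟩ := hFCB
  replace hF : FunctionalCorrelationBoundWith μ T η γ C₀ := hF
  obtain ⟨C, hC, hblocks⟩ := hF.exists_integral_alternateBlocks_le hC₀.le hγ hT
  refine ⟨3 ^ (2 * γ) * (2 * C + 2 ^ γ), by positivity, ?_⟩
  intro v Vinf Vh hVinf hVh hvb hvh hmean D hD k hk n hkn hS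
  set V := Vinf + Vh with hV
  have hV0 : 0 ≤ V := by positivity
  have hv : IsBddMeasurable v V :=
    ⟨(continuous_of_abs_sub_le_dist_rpow hη0 hvh).measurable, fun x => (hvb x).trans (by linarith)⟩
  have hvh' : ∀ x y, |v x - v y| ≤ V * dist x y ^ η := fun x y => (hvh x y).trans (by
    gcongr
    linarith)
  have hvi : ∀ i, IsBddMeasurable (fun x => v (T^[i] x)) V := fun i =>
    hv.comp (hT.iterate i).measurable
  have hs0 : 0 < 2 * γ := by linarith
  set l := n / (2 * k) with hl
  have hl0 : 0 < l := Nat.div_pos hkn (by omega)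
  have hln : 2 * k * l ≤ n := Nat.mul_div_le n (2 * k)
  have hnl : n < 2 * k * (l + 1) := Nat.lt_mul_div_succ n (by omega)
  obtain ⟨r, hr⟩ := Nat.exists_eq_add_of_le hln
  have hr2 : r ≤ 2 * k := by
    rw [mul_add, mul_one] at hnl
    omega
  have hlk : l * k ≤ n := le_trans (by nlinarith) hln
  have hlltn : l < n := by nlinarith
  have hB : ∫ x, |∑ i ∈ Finset.range l, v (T^[i] x)| ^ (2 * γ) ∂μ ≤
      (D * (l : ℝ) ^ ((1 : ℝ) / 2) * V) ^ (2 * γ) := by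
    have h := ENNReal.rpow_le_rpow (hS l hl0 hlltn) hs0.le
    rwa [eLpNorm_rpow_eq_ofReal_integral (IsBddMeasurable.sum hvi) hs0,
      ENNReal.ofReal_rpow_of_nonneg (by positivity) hs0.le,
      ENNReal.ofReal_le_ofReal_iff (by positivity)] at h
  have hA := hblocks v V hv hvh' hV0 hmean D k l n hD.le hk hl0 hlk hnl.le hB
  rw [eLpNorm_rpow_eq_ofReal_integral (IsBddMeasurable.sum hvi) hs0]
  refine ENNReal.ofReal_le_ofReal ?_
  set W := ((k : ℝ) ^ (1 + γ) + (k : ℝ) ^ (1 - γ) * D ^ (2 * γ)) * (n : ℝ) ^ γ * V ^ (2 * γ)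
    with hW
  set A := fun x => ∑ i ∈ Finset.range (k * l), v (T^[alternateBlocks l i] x) with hAdef
  set X := fun x => ∑ i ∈ Finset.range r, v (T^[2 * l * k + i] x) with hX
  have hAb : IsBddMeasurable A _ := IsBddMeasurable.sum fun i => hvi (alternateBlocks l i)
  have hXb : IsBddMeasurable X _ := IsBddMeasurable.sum fun i => hvi (2 * l * k + i)
  have hdecomp : ∀ x, ∑ i ∈ Finset.range n, v (T^[i] x) = A x + A (T^[l] x) + X x := fun x => by
    rw [hr, show 2 * k * l = 2 * l * k by ring, Finset.sum_range_add,
      sum_range_eq_sum_alternateBlocks]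
    simp only [hAdef, hX, iterate_add_apply]
  have i1 : Integrable (fun x => |A x| ^ (2 * γ)) μ := (hAb.abs_rpow hs0.le).integrable
  have i2 : Integrable (fun x => |A (T^[l] x)| ^ (2 * γ)) μ :=
    ((hAb.abs_rpow hs0.le).comp (hT.iterate l).measurable).integrable
  have i3 : Integrable (fun x => |X x| ^ (2 * γ)) μ := (hXb.abs_rpow hs0.le).integrable
  have i12 : Integrable (fun x => |A x| ^ (2 * γ) + |A (T^[l] x)| ^ (2 * γ)) μ := i1.add i2
  have hk1 : (1 : ℝ) ≤ k := by exact_mod_cast hk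
  have hk0 : (0 : ℝ) < k := by linarith
  have hXW : ∫ x, |X x| ^ (2 * γ) ∂μ ≤ 2 ^ γ * W := by
    have hpt : ∀ x, |X x| ^ (2 * γ) ≤ (2 * k * V) ^ (2 * γ) := fun x => by
      refine Real.rpow_le_rpow (abs_nonneg _) ((hXb.bound x).trans ?_) hs0.le
      rw [Finset.card_range]
      have : (r : ℝ) ≤ 2 * k := by exact_mod_cast hr2
      gcongr
    have hkn' : (2 * k : ℝ) ≤ n := by exact_mod_cast hkn
    calc _ ≤ ∫ _, (2 * k * V) ^ (2 * γ) ∂μ := integral_mono i3 (integrable_const _) hpt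
      _ = (2 * k : ℝ) ^ γ * (2 * k : ℝ) ^ γ * V ^ (2 * γ) := by
        rw [integral_const, probReal_univ, one_smul, Real.mul_rpow (by positivity) hV0, two_mul γ,
          Real.rpow_add (by positivity)]
      _ ≤ (2 * k : ℝ) ^ γ * (n : ℝ) ^ γ * V ^ (2 * γ) := by gcongr
      _ = 2 ^ γ * ((k : ℝ) ^ γ * (n : ℝ) ^ γ * V ^ (2 * γ)) := by
        rw [Real.mul_rpow (by norm_num) hk0.le]
        ring
      _ ≤ 2 ^ γ * W := by
        have h1 : (k : ℝ) ^ γ ≤ (k : ℝ) ^ (1 + γ) :=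
          Real.rpow_le_rpow_of_exponent_le hk1 (by linarith)
        have h2 : 0 ≤ (k : ℝ) ^ (1 - γ) * D ^ (2 * γ) := by positivity
        rw [hW]
        gcongr
        linarith
  calc ∫ x, |∑ i ∈ Finset.range n, v (T^[i] x)| ^ (2 * γ) ∂μ
      ≤ ∫ x, 3 ^ (2 * γ) * (|A x| ^ (2 * γ) + |A (T^[l] x)| ^ (2 * γ) + |X x| ^ (2 * γ)) ∂μ := by
        refine integral_mono_of_nonneg (Filter.Eventually.of_forall fun x => by positivity)
          ((i12.add i3).const_mul _) (Filter.Eventually.of_forall fun x => ?_)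
        simp only [hdecomp]
        exact abs_add_add_rpow_le hs0.le _ _ _
    _ = 3 ^ (2 * γ) * (∫ x, |A x| ^ (2 * γ) ∂μ + ∫ x, |A x| ^ (2 * γ) ∂μ +
          ∫ x, |X x| ^ (2 * γ) ∂μ) := by
        rw [integral_const_mul, integral_add i12 i3, integral_add i1 i2,
          hT.integral_comp_iterate (hAb.abs_rpow hs0.le).measurable]
    _ ≤ 3 ^ (2 * γ) * (C * W + C * W + 2 ^ γ * W) := by gcongr
    _ = _ := by rw [hW]; ring
end
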